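/- arXiv:1712.01251 — 3 statements merged into one kernel-verified Lean document; each statement's English description precedes it below -/
import Mathlib

section
/- Let 𝒜 be an elliptic homogeneous constant-coefficient differential operator of order k ≥ n on ℝ^n satisfying condition (WC), and define the linear map 𝓛 : W → V ⊙^{k−n} ℝ^n by 𝓛w := ∫_{𝕊^{n−1}} 𝒜†[ξ]w ⊗^{k−n} ξ dℋ^{n−1}(ξ). Then there exist an integer l ≥ 1 and a constant C such that for every u ∈ C^∞_c(ℝ^n, V) and every φ ∈ C^∞(ℝ^n \ {0}, im 𝓛*) with |x|^j |D^j φ(x)| ∈ L¹_loc(ℝ^n) for j = 0, 1, …, l, one has |∫_{ℝ^n} ⟨φ, 𝒜u⟩ dx| ≤ C ∑_{j=1}^{l} ∫_{ℝ^n} |𝒜u(x)| |x|^j |D^j φ(x)| dx. -/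
open MeasureTheory Metric Filter
open scoped ENNReal RealInnerProductSpace Topology

noncomputable section

/-- Euclidean space `ℝ^n`. -/
abbrev Euc (n : ℕ) : Type := EuclideanSpace ℝ (Fin n)

/-- The `i`-th standard basis vector of `ℝ^n`. -/
def stdVec (n : ℕ) (i : Fin n) : Euc n := EuclideanSpace.single i (1 : ℝ)

/-- Coefficients `A_I : V →ₗ W` (indexed by `I : Fin k → Fin n`) of a homogeneous linear
constant-coefficient differential operator `𝒜 u = ∑_I A_I ∂_I u` of order `k` on `ℝ^n`. -/
abbrev CoeffOp (n k : ℕ) (V W : Type*) [NormedAddCommGroup V] [InnerProductSpace ℝ V]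
    [NormedAddCommGroup W] [InnerProductSpace ℝ W] : Type _ :=
  (Fin k → Fin n) → (V →ₗ[ℝ] W)

variable {V W F : Type*}
  [NormedAddCommGroup V] [InnerProductSpace ℝ V] [FiniteDimensional ℝ V]
  [NormedAddCommGroup W] [InnerProductSpace ℝ W] [FiniteDimensional ℝ W]

/-- The coefficients represent a linear map on symmetric tensors `V ⊙^k ℝ^n`. -/
def IsSymmetricOp (n k : ℕ) (A : CoeffOp n k V W) : Prop :=
  ∀ (I : Fin k → Fin n) (σ : Equiv.Perm (Fin k)), A (I ∘ σ) = A I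

/-- The symbol `𝒜[ξ] v = A (v ⊗^k ξ) = ∑_I (∏ i, ξ_{I i}) A_I v`. -/
def symbolMap (n k : ℕ) (A : CoeffOp n k V W) (ξ : Euc n) : V →ₗ[ℝ] W :=
  ∑ I : Fin k → Fin n, (∏ i, ξ (I i)) • A I

/-- Ellipticity: the symbol is injective for all `ξ ≠ 0`. -/
def IsElliptic (n k : ℕ) (A : CoeffOp n k V W) : Prop :=
  ∀ ξ : Euc n, ξ ≠ 0 → Function.Injective (symbolMap n k A ξ)

/-- Van Schaftingen's cancellation condition: `⋂_{ξ ∈ 𝕊^{n-1}} im 𝒜[ξ] = {0}`. -/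
def IsCanceling (n k : ℕ) (A : CoeffOp n k V W) : Prop :=
  (⋂ ξ ∈ sphere (0 : Euc n) 1, (LinearMap.range (symbolMap n k A ξ) : Set W)) = {0}

/-- Inverse of an endomorphism (junk value when not invertible), via matrix inversion. -/
def linInv (f : V →ₗ[ℝ] V) : V →ₗ[ℝ] V :=
  letI b := Module.finBasis ℝ V
  Matrix.toLin b b ((LinearMap.toMatrix b b f)⁻¹)

/-- `𝒜†[ξ] = (𝒜*[ξ] 𝒜[ξ])⁻¹ 𝒜*[ξ]`. -/
def Adagger (n k : ℕ) (A : CoeffOp n k V W) (ξ : Euc n) : W →ₗ[ℝ] V :=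
  linInv (LinearMap.adjoint (symbolMap n k A ξ) ∘ₗ symbolMap n k A ξ) ∘ₗ
    LinearMap.adjoint (symbolMap n k A ξ)

/-- Condition (WC): for every `w ∈ ⋂_{ξ ∈ 𝕊^{n-1}} im 𝒜[ξ]`,
`∫_{𝕊^{n-1}} 𝒜†[ξ] w ⊗^{k-n} ξ dℋ^{n-1}(ξ) = 0`, written componentwise in the
tensor coordinates indexed by `J : Fin (k-n) → Fin n`. -/
def IsWeaklyCanceling (n k : ℕ) (A : CoeffOp n k V W) : Prop :=
  ∀ w : W, (∀ ξ ∈ sphere (0 : Euc n) 1, w ∈ LinearMap.range (symbolMap n k A ξ)) →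
    ∀ J : Fin (k - n) → Fin n,
      (∫ ξ in sphere (0 : Euc n) 1,
        (∏ i, ξ (J i)) • (Adagger n k A ξ w) ∂(μH[(n : ℝ) - 1])) = 0

section TestFun

variable [NormedAddCommGroup F] [NormedSpace ℝ F]

/-- Compactly supported smooth test function. -/
def IsTestFun (n : ℕ) (φ : Euc n → F) : Prop :=
  ContDiff ℝ (⊤ : ℕ∞) φ ∧ HasCompactSupport φ

/-- Iterated directional derivative `∂_{I 0} ⋯ ∂_{I (m-1)} φ (x)`. -/
def dirDeriv (n m : ℕ) (I : Fin m → Fin n) (φ : Euc n → F) (x : Euc n) : F :=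
  iteratedFDeriv ℝ m φ x (fun i => stdVec n (I i))

/-- Smooth functions of degree-`≤ j` polynomial type. -/
def IsPolyDeg (n : ℕ) (j : ℕ) (P : Euc n → F) : Prop :=
  ContDiff ℝ (⊤ : ℕ∞) P ∧ ∀ x, iteratedFDeriv ℝ (j + 1) P x = 0

end TestFun

/-- Pointwise application of the operator `𝒜` to a smooth map. -/
def Aapply (n k : ℕ) (A : CoeffOp n k V W) (u : Euc n → V) (x : Euc n) : W :=
  ∑ I : Fin k → Fin n, A I (dirDeriv n k I u x)

/-- `𝒜 u = f σ` (a `W`-valued measure with total-variation measure `σ` and polar density `f`)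
in the sense of distributions. -/
def HasDistribA (n k : ℕ) (A : CoeffOp n k V W) (u : Euc n → V) (σ : Measure (Euc n))
    (f : Euc n → W) : Prop :=
  ∀ φ : Euc n → W, IsTestFun n φ →
    ((-1 : ℝ) ^ k) * (∑ I : Fin k → Fin n,
        ∫ x, ⟪u x, LinearMap.adjoint (A I) (dirDeriv n k I φ x)⟫) =
      ∫ x, ⟪f x, φ x⟫ ∂σ

/-- `u ∈ BV^𝒜_loc(ℝ^n)`: `u` is locally integrable and `𝒜 u` is a `W`-valued Radon measure,
given by its polar decomposition `f σ` with `σ` locally finite and `‖f‖ = 1` σ-a.e. -/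
def MemBVAloc (n k : ℕ) (A : CoeffOp n k V W) (u : Euc n → V) : Prop :=
  LocallyIntegrable u volume ∧
    ∃ (σ : Measure (Euc n)) (f : Euc n → W), IsLocallyFiniteMeasure σ ∧
      LocallyIntegrable f σ ∧ (∀ᵐ x ∂σ, ‖f x‖ = 1) ∧ HasDistribA n k A u σ f

/-- `v` is the family of weak derivatives of order `m` of `u` (componentwise, indexed by
`I : Fin m → Fin n`). -/
def IsWeakDerivFamily (n m : ℕ) (u : Euc n → V) (v : (Fin m → Fin n) → Euc n → V) : Prop :=
  (∀ I, LocallyIntegrable (v I) volume) ∧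
    ∀ (I : Fin m → Fin n) (φ : Euc n → ℝ), IsTestFun n φ →
      ∫ x, (dirDeriv n m I φ x) • u x = ((-1 : ℝ) ^ m) • ∫ x, φ x • v I x

/-- `Q r = o(r^a)` as `r ↓ 0`. -/
def SmallO (Q : ℝ → ℝ≥0∞) (a : ℝ) : Prop :=
  Tendsto (fun r => Q r / ENNReal.ofReal (r ^ a)) (𝓝[>] (0 : ℝ)) (𝓝 0)

section Spaces

variable [NormedAddCommGroup F] [NormedSpace ℝ F]

/-- `f ∈ t^{j,p}(x)`: there is a polynomial `P` of degree at most `j` with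
`(⨍_{B_r(x)} |f - P|^p)^{1/p} = o(r^j)` as `r ↓ 0`. -/
def MemT (n : ℕ) (j : ℕ) (p : ℝ) (f : Euc n → F) (x : Euc n) : Prop :=
  ∃ P : Euc n → F, IsPolyDeg n j P ∧
    SmallO (fun r => ((volume (ball x r))⁻¹ *
      ∫⁻ y in ball x r, (‖f y - P y‖₊ : ℝ≥0∞) ^ p) ^ (1 / p)) (j : ℝ)

/-- `f ∈ t^{j,∞}(x)`: there is a polynomial `P` of degree at most `j` with
`‖f - P‖_{L^∞(B_r(x))} = o(r^j)` as `r ↓ 0`. -/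
def MemTInf (n : ℕ) (j : ℕ) (f : Euc n → F) (x : Euc n) : Prop :=
  ∃ P : Euc n → F, IsPolyDeg n j P ∧
    SmallO (fun r => essSup (fun y => (‖f y - P y‖₊ : ℝ≥0∞))
      (volume.restrict (ball x r))) (j : ℝ)

/-- The Lorentz `L^{p,q}` quasi-norm (for `p, q < ∞`). -/
def lorentzNorm {α : Type*} [MeasurableSpace α] (p q : ℝ) (μ : Measure α) (f : α → F) : ℝ≥0∞ :=
  ENNReal.ofReal p ^ (1 / q) *
    (∫⁻ t in Set.Ioi (0 : ℝ),
      (ENNReal.ofReal t * (μ {x | t < ‖f x‖}) ^ (1 / p)) ^ q * (ENNReal.ofReal t)⁻¹) ^ (1 / q)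

/-- `f` is `L^{p,q}`-differentiable of order `j` at `x`:
`‖f - P‖_{L^{p,q}(B_r(x))} = o(r^{j + n/p})` for a polynomial `P` of degree at most `j`. -/
def MemTLorentz (n : ℕ) (j : ℕ) (p q : ℝ) (f : Euc n → F) (x : Euc n) : Prop :=
  ∃ P : Euc n → F, IsPolyDeg n j P ∧
    SmallO (fun r => lorentzNorm p q (volume.restrict (ball x r)) (fun y => f y - P y))
      ((j : ℝ) + n / p)

/-- `f ∈ L^p_loc`. -/
def LocLp (n : ℕ) (p : ℝ) (f : Euc n → F) : Prop :=
  ∀ K : Set (Euc n), IsCompact K → ∫⁻ x in K, (‖f x‖₊ : ℝ≥0∞) ^ p < ⊤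

end Spaces

end

/-- `w` lies in the kernel of the map `𝓛 : W → V ⊙^{k-n} ℝ^n`,
`𝓛 w = ∫_{𝕊^{n-1}} 𝒜†[ξ] w ⊗^{k-n} ξ dℋ^{n-1}(ξ)` (written componentwise). -/
def InKerL (n k : ℕ) {V W : Type*}
    [NormedAddCommGroup V] [InnerProductSpace ℝ V] [FiniteDimensional ℝ V]
    [NormedAddCommGroup W] [InnerProductSpace ℝ W] [FiniteDimensional ℝ W]
    (A : CoeffOp n k V W) (w : W) : Prop :=
  ∀ J : Fin (k - n) → Fin n,
    (∫ ξ in sphere (0 : Euc n) 1,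
      (∏ i, ξ (J i)) • (Adagger n k A ξ w) ∂(μH[(n : ℝ) - 1])) = 0

/-- The space of smooth real-valued functions on `ℝ^n`. -/
def smoothFun (n : ℕ) : Submodule ℝ (Euc n → ℝ) where
  carrier := {f | ContDiff ℝ (⊤ : ℕ∞) f}
  add_mem' hf hg := by
    rw [Set.mem_ofPred_eq] at *
    exact hf.add hg
  zero_mem' := by
    rw [Set.mem_ofPred_eq]
    exact contDiff_const
  smul_mem' c f hf := by
    rw [Set.mem_ofPred_eq] at *
    exact hf.const_smul c

lemma smoothFun_contDiff {n : ℕ} (f : smoothFun n) : ContDiff ℝ (⊤ : ℕ∞) (f : Euc n → ℝ) := f.2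

lemma smoothFun_differentiable {n : ℕ} (f : smoothFun n) : Differentiable ℝ (f : Euc n → ℝ) :=
  (smoothFun_contDiff f).differentiable (by simp)

/-- The partial derivative `∂_i`, as an endomorphism of the space of smooth functions. -/
noncomputable def partialEnd (n : ℕ) (i : Fin n) : Module.End ℝ (smoothFun n) where
  toFun f := ⟨fun x => fderiv ℝ (f : Euc n → ℝ) x (stdVec n i), by
    change ContDiff ℝ (⊤ : ℕ∞) fun x => fderiv ℝ (f : Euc n → ℝ) x (stdVec n i)
    exact ((smoothFun_contDiff f).fderiv_right (m := (⊤ : ℕ∞))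
      (by norm_cast)).clm_apply contDiff_const⟩
  map_add' f g := by
    ext x
    simp [fderiv_add (smoothFun_differentiable f x) (smoothFun_differentiable g x)]
  map_smul' c f := by
    ext x
    simp [fderiv_const_smul (smoothFun_differentiable f x)]

lemma partialEnd_apply {n : ℕ} (i : Fin n) (f : smoothFun n) (x : Euc n) :
    (partialEnd n i f : Euc n → ℝ) x = fderiv ℝ (f : Euc n → ℝ) x (stdVec n i) := rfl

lemma partialEnd_commute {n : ℕ} (i j : Fin n) :
    partialEnd n i * partialEnd n j = partialEnd n j * partialEnd n i := by
  have key (i j : Fin n) (f : smoothFun n) (x : Euc n) :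
      (partialEnd n i (partialEnd n j f) : Euc n → ℝ) x =
        fderiv ℝ (fderiv ℝ (f : Euc n → ℝ)) x (stdVec n i) (stdVec n j) := by
    have h : DifferentiableAt ℝ (fderiv ℝ (f : Euc n → ℝ)) x :=
      ((smoothFun_contDiff f).fderiv_right (m := (⊤ : ℕ∞)) (by norm_cast)).differentiable (by simp) x
    change fderiv ℝ (fun y => fderiv ℝ (f : Euc n → ℝ) y (stdVec n j)) x (stdVec n i) = _
    rw [fderiv_clm_apply h (by fun_prop)]
    simp
  ext f x
  have hs : IsSymmSndFDerivAt ℝ (f : Euc n → ℝ) x :=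
    (smoothFun_contDiff f).contDiffAt.isSymmSndFDerivAt (by
      rw [minSmoothness_of_isRCLikeNormedField]; exact ENat.LEInfty.out)
  exact (key i j f x).trans ((hs _ _).trans (key j i f x).symm)

open scoped IsMulCommutative in
/-- The constant-coefficient differential operator `q(∂)` attached to a polynomial `q`. -/
noncomputable def polyDiff (n : ℕ) : MvPolynomial (Fin n) ℝ →ₐ[ℝ] Module.End ℝ (smoothFun n) :=
  haveI : IsMulCommutative (Algebra.adjoin ℝ (Set.range (partialEnd n))) :=
    Algebra.isMulCommutative_adjoin ℝ (by
      rintro _ ⟨i, rfl⟩ _ ⟨j, rfl⟩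
      exact partialEnd_commute i j)
  (Algebra.adjoin ℝ (Set.range (partialEnd n))).val.comp
    (MvPolynomial.aeval fun i => ⟨partialEnd n i, Algebra.subset_adjoin ⟨i, rfl⟩⟩)

lemma polyDiff_X {n : ℕ} (i : Fin n) : polyDiff n (MvPolynomial.X i) = partialEnd n i := by
  simp [polyDiff]

lemma polyDiff_prod_X_apply {n m : ℕ} (I : Fin m → Fin n) (f : smoothFun n) :
    (polyDiff n (∏ i, MvPolynomial.X (I i)) f : Euc n → ℝ) =
      fun x => iteratedFDeriv ℝ m (f : Euc n → ℝ) x (fun i => stdVec n (I i)) := by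
  induction m with
  | zero => ext x; simp
  | succ m ih =>
    ext x
    rw [Fin.prod_univ_succ, map_mul, Module.End.mul_apply, polyDiff_X, partialEnd_apply, ih,
      iteratedFDeriv_succ_apply_left]
    have h : DifferentiableAt ℝ (iteratedFDeriv ℝ m (f : Euc n → ℝ)) x :=
      (smoothFun_contDiff f).differentiable_iteratedFDeriv (by exact_mod_cast ENat.natCast_lt_top m) x
    rw [fderiv_continuousMultilinear_apply_const_apply h]
    rfl

lemma isHomogeneous_mem_span_prod_X {n m : ℕ} {q : MvPolynomial (Fin n) ℝ}
    (hq : q.IsHomogeneous m) :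
    q ∈ Submodule.span ℝ
      (Set.range fun I : Fin m → Fin n => ∏ i, (MvPolynomial.X (I i) : MvPolynomial (Fin n) ℝ)) := by
  rw [← MvPolynomial.mem_homogeneousSubmodule, ← MvPolynomial.homogeneousSubmodule_one_pow,
    MvPolynomial.homogeneousSubmodule_one_eq_span_X, Submodule.span_pow] at hq
  refine Submodule.span_mono ?_ hq
  intro p hp
  obtain ⟨f, rfl⟩ := Set.mem_pow.mp hp
  choose I hI using fun i => (f i).2
  refine ⟨I, ?_⟩
  simp [hI, List.prod_ofFn]

lemma norm_stdVec {n : ℕ} (i : Fin n) : ‖stdVec n i‖ = 1 := by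
  simp [stdVec]

/-- A homogeneous operator of order `m` is controlled by the full derivative of order `m`. -/
lemma exists_abs_polyDiff_le {n m : ℕ} {q : MvPolynomial (Fin n) ℝ} (hq : q.IsHomogeneous m) :
    ∃ C : ℝ, 0 ≤ C ∧ ∀ (f : smoothFun n) (x : Euc n),
      |(polyDiff n q f : Euc n → ℝ) x| ≤ C * ‖iteratedFDeriv ℝ m (f : Euc n → ℝ) x‖ := by
  replace hq := isHomogeneous_mem_span_prod_X hq
  induction hq using Submodule.span_induction with
  | mem p hp =>
    obtain ⟨I, rfl⟩ := hp
    refine ⟨1, zero_le_one, fun f x => ?_⟩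
    rw [polyDiff_prod_X_apply]
    refine ((iteratedFDeriv ℝ m (f : Euc n → ℝ) x).le_opNorm _).trans ?_
    simp [norm_stdVec]
  | zero => exact ⟨0, le_rfl, fun f x => by simp⟩
  | add p q _ _ hp hq =>
    obtain ⟨C, hC, h⟩ := hp
    obtain ⟨C', hC', h'⟩ := hq
    refine ⟨C + C', add_nonneg hC hC', fun f x => ?_⟩
    rw [map_add, add_mul]
    exact (abs_add_le _ _).trans (add_le_add (h f x) (h' f x))
  | smul c p _ hp =>
    obtain ⟨C, hC, h⟩ := hp
    refine ⟨|c| * C, by positivity, fun f x => ?_⟩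
    rw [map_smul, mul_assoc]
    exact (abs_mul _ _).trans_le (mul_le_mul_of_nonneg_left (h f x) (abs_nonneg c))

lemma smoothFun_integrable_mul {n : ℕ} (f g : smoothFun n)
    (hf : HasCompactSupport (f : Euc n → ℝ)) :
    Integrable (fun x => (g : Euc n → ℝ) x * (f : Euc n → ℝ) x) volume :=
  Continuous.integrable_of_hasCompactSupport
    ((smoothFun_contDiff g).continuous.mul (smoothFun_contDiff f).continuous) hf.mul_left

lemma hasCompactSupport_partialEnd {n : ℕ} (i : Fin n) (f : smoothFun n)
    (hf : HasCompactSupport (f : Euc n → ℝ)) :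
    HasCompactSupport (partialEnd n i f : Euc n → ℝ) :=
  hf.fderiv_apply ℝ (stdVec n i)

lemma integral_mul_partialEnd {n : ℕ} (i : Fin n) (f g : smoothFun n)
    (hf : HasCompactSupport (f : Euc n → ℝ)) :
    ∫ x, (g : Euc n → ℝ) x * (partialEnd n i f : Euc n → ℝ) x =
      -∫ x, (partialEnd n i g : Euc n → ℝ) x * (f : Euc n → ℝ) x :=
  integral_mul_fderiv_eq_neg_fderiv_mul_of_integrable
    (smoothFun_integrable_mul f (partialEnd n i g) hf)
    (smoothFun_integrable_mul (partialEnd n i f) g (hasCompactSupport_partialEnd i f hf))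
    (smoothFun_integrable_mul f g hf) (fun x _ => (smoothFun_differentiable g x))
    (fun x _ => (smoothFun_differentiable f x))

/-- Integration by parts for a homogeneous constant-coefficient operator. -/
lemma integral_mul_polyDiff {n m : ℕ} {q : MvPolynomial (Fin n) ℝ} (hq : q.IsHomogeneous m)
    (f : smoothFun n) (hf : HasCompactSupport (f : Euc n → ℝ)) (g : smoothFun n) :
    HasCompactSupport (polyDiff n q f : Euc n → ℝ) ∧
    ∫ x, (g : Euc n → ℝ) x * (polyDiff n q f : Euc n → ℝ) x =
      (-1) ^ m * ∫ x, (polyDiff n q g : Euc n → ℝ) x * (f : Euc n → ℝ) x := by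
  replace hq := isHomogeneous_mem_span_prod_X hq
  induction hq using Submodule.span_induction with
  | mem p hp =>
    obtain ⟨I, rfl⟩ := hp
    induction m generalizing f g with
    | zero => simpa using hf
    | succ m ih =>
      simp only [Fin.prod_univ_castSucc, map_mul, Module.End.mul_apply, polyDiff_X]
      obtain ⟨h1, h2⟩ := ih (partialEnd n (I (Fin.last m)) f)
        (hasCompactSupport_partialEnd _ f hf) g (fun i => I i.castSucc)
      refine ⟨h1, h2.trans ?_⟩
      rw [integral_mul_partialEnd _ _ _ hf, ← Module.End.mul_apply, ← polyDiff_X, ← map_mul,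
        mul_comm (MvPolynomial.X _), map_mul, Module.End.mul_apply]
      ring
  | zero => exact ⟨by simpa using HasCompactSupport.zero, by simp⟩
  | add p q _ _ hp hq =>
    refine ⟨by simpa using hp.1.add hq.1, ?_⟩
    simp only [map_add, LinearMap.add_apply, Submodule.coe_add, Pi.add_apply, mul_add, add_mul]
    rw [integral_add (smoothFun_integrable_mul _ _ hp.1) (smoothFun_integrable_mul _ _ hq.1),
      integral_add (smoothFun_integrable_mul _ _ hf) (smoothFun_integrable_mul _ _ hf),
      hp.2, hq.2, mul_add]
  | smul c p _ hp =>
    refine ⟨by simpa using! hp.1.smul_left (f := fun _ => c), ?_⟩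
    simp only [map_smul, LinearMap.smul_apply, Submodule.coe_smul, Pi.smul_apply, smul_eq_mul,
      mul_left_comm _ c, mul_assoc, integral_const_mul]
    rw [hp.2, mul_left_comm]

/-- The derivation of the polynomial ring along the vector `η`. -/
noncomputable def dirDerivation {n : ℕ} (η : Euc n) :
    Derivation ℝ (MvPolynomial (Fin n) ℝ) (MvPolynomial (Fin n) ℝ) :=
  ∑ i, η i • MvPolynomial.pderiv i

lemma dirDerivation_apply {n : ℕ} (η : Euc n) (q : MvPolynomial (Fin n) ℝ) :
    dirDerivation η q = ∑ i, η i • MvPolynomial.pderiv i q := by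
  have h := congrFun (map_sum (Derivation.coeFnAddMonoidHom (R := ℝ)
    (A := MvPolynomial (Fin n) ℝ) (M := MvPolynomial (Fin n) ℝ))
    (fun i => η i • MvPolynomial.pderiv i) Finset.univ) q
  simp only [Derivation.coeFnAddMonoidHom_apply, Finset.sum_apply, Derivation.coe_smul,
    Pi.smul_apply] at h
  exact h

lemma dirDerivation_X {n : ℕ} (η : Euc n) (i : Fin n) :
    dirDerivation η (MvPolynomial.X i) = MvPolynomial.C (η i) := by
  simp [dirDerivation_apply, MvPolynomial.pderiv_X, Pi.single_apply, MvPolynomial.smul_eq_C_mul]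

lemma isHomogeneous_dirDerivation {n m : ℕ} (η : Euc n) {q : MvPolynomial (Fin n) ℝ}
    (hq : q.IsHomogeneous m) : (dirDerivation η q).IsHomogeneous (m - 1) := by
  rw [dirDerivation_apply]
  refine MvPolynomial.IsHomogeneous.sum _ _ _ fun i _ => ?_
  rw [MvPolynomial.smul_eq_C_mul]
  exact hq.pderiv.C_mul _

lemma eval_dirDerivation {n m : ℕ} (η : Euc n) {q : MvPolynomial (Fin n) ℝ}
    (hq : q.IsHomogeneous m) :
    MvPolynomial.eval (fun i => η i) (dirDerivation η q) =
      m * MvPolynomial.eval (fun i => η i) q := by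
  have h := congrArg (MvPolynomial.eval (fun i => η i)) hq.sum_X_mul_pderiv
  simpa [dirDerivation_apply, MvPolynomial.smul_eval] using h

lemma isHomogeneous_iterate_dirDerivation {n m : ℕ} (η : Euc n) {q : MvPolynomial (Fin n) ℝ}
    (hq : q.IsHomogeneous m) (j : ℕ) :
    ((dirDerivation η)^[j] q).IsHomogeneous (m - j) := by
  induction j with
  | zero => simpa using hq
  | succ j ih =>
    rw [Function.iterate_succ_apply', ← Nat.sub_sub]
    exact isHomogeneous_dirDerivation η ih

lemma iterate_dirDerivation_eq {n m : ℕ} (η : Euc n) {q : MvPolynomial (Fin n) ℝ}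
    (hq : q.IsHomogeneous m) :
    (dirDerivation η)^[m] q =
      MvPolynomial.C ((m.factorial : ℝ) * MvPolynomial.eval (fun i => η i) q) := by
  induction m generalizing q with
  | zero =>
    obtain ⟨c, rfl⟩ : ∃ c, q = MvPolynomial.C c :=
      ⟨_, MvPolynomial.totalDegree_eq_zero_iff_eq_C.mp
        ((MvPolynomial.totalDegree_zero_iff_isHomogeneous _).mpr hq)⟩
    simp
  | succ m ih =>
    rw [Function.iterate_succ_apply, ih (isHomogeneous_dirDerivation η hq),
      eval_dirDerivation η hq, Nat.factorial_succ]
    push_cast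
    ring_nf

/-- The linear function `x ↦ ⟪η, x⟫`. -/
noncomputable def innerFun {n : ℕ} (η : Euc n) : smoothFun n :=
  ⟨fun x => ⟪η, x⟫, by
    change ContDiff ℝ (⊤ : ℕ∞) fun x => ⟪η, x⟫
    exact contDiff_const.inner ℝ contDiff_id⟩

/-- Multiplication by a smooth function. -/
noncomputable def mulEnd {n : ℕ} (h : smoothFun n) : Module.End ℝ (smoothFun n) where
  toFun f := ⟨(h : Euc n → ℝ) * (f : Euc n → ℝ), (smoothFun_contDiff h).mul (smoothFun_contDiff f)⟩
  map_add' f g := by ext x; simp [mul_add]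
  map_smul' c f := by ext x; simp [mul_left_comm]

lemma mulEnd_apply {n : ℕ} (h f : smoothFun n) (x : Euc n) :
    (mulEnd h f : Euc n → ℝ) x = (h : Euc n → ℝ) x * (f : Euc n → ℝ) x := rfl

lemma mulEnd_pow_apply {n : ℕ} (h f : smoothFun n) (m : ℕ) (x : Euc n) :
    ((mulEnd h ^ m) f : Euc n → ℝ) x = (h : Euc n → ℝ) x ^ m * (f : Euc n → ℝ) x := by
  induction m with
  | zero => simp
  | succ m ih => rw [pow_succ', Module.End.mul_apply, mulEnd_apply, ih, pow_succ']; ring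

lemma partialEnd_mul_mulEnd {n : ℕ} (η : Euc n) (i : Fin n) :
    partialEnd n i * mulEnd (innerFun η) = mulEnd (innerFun η) * partialEnd n i +
      algebraMap ℝ _ (η i) := by
  ext f x
  have h1 : fderiv ℝ (innerFun η : Euc n → ℝ) x = innerSL ℝ η := (innerSL ℝ η).fderiv
  change fderiv ℝ ((innerFun η : Euc n → ℝ) * (f : Euc n → ℝ)) x (stdVec n i) =
    (innerFun η : Euc n → ℝ) x * fderiv ℝ (f : Euc n → ℝ) x (stdVec n i) +
      η i * (f : Euc n → ℝ) x
  rw [fderiv_mul (smoothFun_differentiable _ x) (smoothFun_differentiable _ x), h1]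
  simp [stdVec, EuclideanSpace.inner_single_right]
  ring

lemma polyDiff_mul_mulEnd {n : ℕ} (η : Euc n) (q : MvPolynomial (Fin n) ℝ) :
    polyDiff n q * mulEnd (innerFun η) = mulEnd (innerFun η) * polyDiff n q +
      polyDiff n (dirDerivation η q) := by
  induction q using MvPolynomial.induction_on with
  | C a =>
    rw [← MvPolynomial.algebraMap_eq, AlgHom.commutes, Derivation.map_algebraMap, map_zero,
      add_zero, Algebra.commutes]
  | add p q hp hq => simp only [map_add, add_mul, mul_add, hp, hq]; abel
  | mul_X p i hp =>
    rw [map_mul, polyDiff_X, mul_assoc, partialEnd_mul_mulEnd, mul_add, ← mul_assoc, hp,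
      Derivation.leibniz, dirDerivation_X, map_add, smul_eq_mul, smul_eq_mul,
      mul_comm (MvPolynomial.X i), map_mul, map_mul, polyDiff_X, ← MvPolynomial.algebraMap_eq,
      AlgHom.commutes, add_mul, mul_assoc]
    abel

lemma polyDiff_mul_mulEnd_pow {n : ℕ} (η : Euc n) (m : ℕ) (q : MvPolynomial (Fin n) ℝ) :
    polyDiff n q * mulEnd (innerFun η) ^ m =
      ∑ ij ∈ Finset.HasAntidiagonal.antidiagonal m, m.choose ij.1 •
        (mulEnd (innerFun η) ^ ij.1 * polyDiff n ((dirDerivation η)^[ij.2] q)) := by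
  induction m generalizing q with
  | zero => simp
  | succ m ih =>
    rw [pow_succ', ← mul_assoc, polyDiff_mul_mulEnd, add_mul, mul_assoc, ih, ih,
      Finset.sum_antidiagonal_choose_succ_nsmul
        (fun i j => mulEnd (innerFun η) ^ i * polyDiff n ((dirDerivation η)^[j] q)), add_comm,
      Finset.mul_sum]
    congr 1
    refine Finset.sum_congr rfl fun ij hij => ?_
    rw [mul_smul_comm, ← mul_assoc, ← pow_succ',
      Nat.choose_symm_of_eq_add (Finset.HasAntidiagonal.mem_antidiagonal.mp hij).symm]

/-- Applying a homogeneous operator `q(∂)` of degree `m` to `⟪η, x⟫ ^ m * g` gives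
`m! q(η) g` up to terms `|x|^j |D^j g|` with `1 ≤ j ≤ m`. -/
lemma exists_abs_polyDiff_pow_mul_sub_le {n m : ℕ} (η : Euc n) {q : MvPolynomial (Fin n) ℝ}
    (hq : q.IsHomogeneous m) :
    ∃ C : ℝ, 0 ≤ C ∧ ∀ (g : smoothFun n) (x : Euc n),
      |(polyDiff n q ((mulEnd (innerFun η) ^ m) g) : Euc n → ℝ) x -
        (m.factorial : ℝ) * MvPolynomial.eval (fun i => η i) q * (g : Euc n → ℝ) x| ≤
      C * ∑ j ∈ Finset.Icc 1 m, ‖x‖ ^ j * ‖iteratedFDeriv ℝ j (g : Euc n → ℝ) x‖ := by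
  have h (i : ℕ) : ∃ C : ℝ, 0 ≤ C ∧ (i ≤ m → ∀ (f : smoothFun n) (x : Euc n),
      |(polyDiff n ((dirDerivation η)^[m - i] q) f : Euc n → ℝ) x| ≤
        C * ‖iteratedFDeriv ℝ i (f : Euc n → ℝ) x‖) := by
    obtain ⟨C, hC, h⟩ := exists_abs_polyDiff_le (isHomogeneous_iterate_dirDerivation η hq (m - i))
    refine ⟨C, hC, fun hi => ?_⟩
    rwa [Nat.sub_sub_self hi] at h
  choose C hC h using h
  refine ⟨∑ i ∈ Finset.Icc 1 m, m.choose i * ‖η‖ ^ i * C i,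
    Finset.sum_nonneg fun i _ => by have := hC i; positivity, fun g x => ?_⟩
  have hexp : (polyDiff n q ((mulEnd (innerFun η) ^ m) g) : Euc n → ℝ) x =
      ∑ i ∈ Finset.range (m + 1), m.choose i * (⟪η, x⟫ ^ i *
        (polyDiff n ((dirDerivation η)^[m - i] q) g : Euc n → ℝ) x) := by
    rw [← Module.End.mul_apply, polyDiff_mul_mulEnd_pow,
      Finset.Nat.sum_antidiagonal_eq_sum_range_succ_mk]
    simp [mulEnd_pow_apply, innerFun]
  have hsplit : Finset.range (m + 1) = insert 0 (Finset.Icc 1 m) := by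
    ext i
    simp only [Finset.mem_range, Finset.mem_insert, Finset.mem_Icc]
    omega
  rw [hexp, hsplit, Finset.sum_insert (by simp)]
  have h0 : (polyDiff n ((dirDerivation η)^[m] q) g : Euc n → ℝ) x =
      (m.factorial : ℝ) * MvPolynomial.eval (fun i => η i) q * (g : Euc n → ℝ) x := by
    rw [iterate_dirDerivation_eq η hq, ← MvPolynomial.algebraMap_eq, AlgHom.commutes]
    rfl
  simp only [Nat.choose_zero_right, Nat.cast_one, pow_zero, one_mul, Nat.sub_zero, h0,
    add_sub_cancel_left]
  refine (Finset.abs_sum_le_sum_abs _ _).trans ?_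
  rw [Finset.sum_mul]
  refine Finset.sum_le_sum fun i hi => ?_
  have him := (Finset.mem_Icc.mp hi).2
  have h1 : ‖x‖ ^ i * ‖iteratedFDeriv ℝ i (g : Euc n → ℝ) x‖ ≤
      ∑ j ∈ Finset.Icc 1 m, ‖x‖ ^ j * ‖iteratedFDeriv ℝ j (g : Euc n → ℝ) x‖ :=
    Finset.single_le_sum
      (f := fun j => ‖x‖ ^ j * ‖iteratedFDeriv ℝ j (g : Euc n → ℝ) x‖)
      (fun j _ => by positivity) hi
  rw [abs_mul, abs_mul, abs_pow, Nat.abs_cast]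
  calc (m.choose i : ℝ) * (|⟪η, x⟫| ^ i *
        |(polyDiff n ((dirDerivation η)^[m - i] q) g : Euc n → ℝ) x|)
      ≤ m.choose i * ((‖η‖ * ‖x‖) ^ i * (C i * ‖iteratedFDeriv ℝ i (g : Euc n → ℝ) x‖)) := by
        gcongr
        · exact abs_real_inner_le_norm η x
        · exact h i him g x
    _ = m.choose i * ‖η‖ ^ i * C i *
        (‖x‖ ^ i * ‖iteratedFDeriv ℝ i (g : Euc n → ℝ) x‖) := by rw [mul_pow]; ring
    _ ≤ _ := by
        have := hC i
        gcongr

lemma isHomogeneous_det {σ ι : Type*} [Fintype ι] [DecidableEq ι]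
    {M : Matrix ι ι (MvPolynomial σ ℝ)} {r : ι → ℕ}
    (h : ∀ i j, (M i j).IsHomogeneous (r i)) : M.det.IsHomogeneous (∑ i, r i) := by
  rw [Matrix.det_apply']
  refine MvPolynomial.IsHomogeneous.sum _ _ _ fun s _ => ?_
  have h1 : (∏ i, M (s i) i).IsHomogeneous (∑ i, r (s i)) :=
    MvPolynomial.IsHomogeneous.prod _ _ _ fun i _ => h _ _
  rw [Equiv.sum_comp s r] at h1
  have := h1.C_mul (((Equiv.Perm.sign s : ℤˣ) : ℤ) : ℝ)
  simpa using this

lemma isHomogeneous_mul_entry {σ ι κ τ : Type*} [Fintype κ]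
    {M : Matrix ι κ (MvPolynomial σ ℝ)} {N : Matrix κ τ (MvPolynomial σ ℝ)} {a b : ℕ}
    (hM : ∀ i j, (M i j).IsHomogeneous a) (hN : ∀ i j, (N i j).IsHomogeneous b) (i : ι) (j : τ) :
    ((M * N) i j).IsHomogeneous (a + b) :=
  MvPolynomial.IsHomogeneous.sum _ _ _ fun _ _ => (hM _ _).mul (hN _ _)

lemma isHomogeneous_adjugate {σ ι : Type*} [Fintype ι] [DecidableEq ι]
    {M : Matrix ι ι (MvPolynomial σ ℝ)} {d : ℕ}
    (h : ∀ i j, (M i j).IsHomogeneous d) (i j : ι) :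
    (M.adjugate i j).IsHomogeneous ((Fintype.card ι - 1) * d) := by
  rw [Matrix.adjugate_apply]
  have h1 : ((M.updateRow j (Pi.single i 1)).det).IsHomogeneous
      (∑ a, if a = j then 0 else d) := by
    refine isHomogeneous_det fun a c => ?_
    by_cases ha : a = j
    · subst ha
      rw [Matrix.updateRow_self, if_pos rfl]
      by_cases hc : c = i
      · subst hc
        simpa using MvPolynomial.isHomogeneous_one σ ℝ
      · simpa [Pi.single_apply, hc] using MvPolynomial.isHomogeneous_zero σ ℝ 0
    · rw [Matrix.updateRow_ne ha, if_neg ha]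
      exact h a c
  convert h1 using 1
  rw [← Finset.add_sum_erase _ _ (Finset.mem_univ j), if_pos rfl, zero_add,
    Finset.sum_congr rfl fun a ha => if_neg (Finset.ne_of_mem_erase ha), Finset.sum_const,
    Finset.card_erase_of_mem (Finset.mem_univ j), Finset.card_univ, smul_eq_mul]

/-- A matrix annihilating `P` on the left: `det(PᵀP) - P adj(PᵀP) Pᵀ`. -/
def leftAnnihilator {R ι κ : Type*} [CommRing R] [Fintype ι] [DecidableEq ι] [Fintype κ]
    [DecidableEq κ] (P : Matrix ι κ R) : Matrix ι ι R :=
  (P.transpose * P).det • 1 - P * (P.transpose * P).adjugate * P.transpose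

lemma leftAnnihilator_mul {R ι κ : Type*} [CommRing R] [Fintype ι] [DecidableEq ι] [Fintype κ]
    [DecidableEq κ] (P : Matrix ι κ R) : leftAnnihilator P * P = 0 := by
  rw [leftAnnihilator, Matrix.sub_mul, Matrix.mul_assoc, Matrix.mul_assoc, Matrix.adjugate_mul]
  simp

lemma map_leftAnnihilator {R S ι κ : Type*} [CommRing R] [CommRing S] [Fintype ι] [DecidableEq ι]
    [Fintype κ] [DecidableEq κ] (f : R →+* S) (P : Matrix ι κ R) :
    (leftAnnihilator P).map f = leftAnnihilator (P.map f) := by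
  have h1 : (P.map f).transpose * P.map f = f.mapMatrix (P.transpose * P) := by
    simp [Matrix.map_mul, Matrix.transpose_map]
  rw [leftAnnihilator, leftAnnihilator, h1, ← RingHom.map_det, ← RingHom.map_adjugate]
  ext i j
  simp [Matrix.one_apply, apply_ite f, Matrix.mul_apply]

lemma isHomogeneous_leftAnnihilator {σ ι κ : Type*} [Fintype ι] [DecidableEq ι] [Fintype κ]
    [DecidableEq κ] {P : Matrix ι κ (MvPolynomial σ ℝ)} {k : ℕ}
    (hP : ∀ i j, (P i j).IsHomogeneous k) (i j : ι) :
    (leftAnnihilator P i j).IsHomogeneous (Fintype.card κ * (k + k)) := by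
  have hQ := isHomogeneous_mul_entry (M := P.transpose) (fun i j => hP j i) hP
  have hdet := isHomogeneous_det hQ
  rw [Finset.sum_const, Finset.card_univ, smul_eq_mul] at hdet
  rw [leftAnnihilator, Matrix.sub_apply]
  refine MvPolynomial.IsHomogeneous.sub ?_ ?_
  · rw [Matrix.smul_apply, Matrix.one_apply]
    split_ifs
    · simpa using hdet
    · simpa using MvPolynomial.isHomogeneous_zero σ ℝ _
  · rcases isEmpty_or_nonempty κ with hκ | hκ
    · have h0 : (P * (P.transpose * P).adjugate * P.transpose) i j = 0 := by
        simp [Matrix.mul_apply]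
      rw [h0]
      exact MvPolynomial.isHomogeneous_zero σ ℝ _
    · have h := isHomogeneous_mul_entry (isHomogeneous_mul_entry hP (isHomogeneous_adjugate hQ))
        (N := P.transpose) (fun i j => hP j i) i j
      have hdeg : k + (Fintype.card κ - 1) * (k + k) + k = Fintype.card κ * (k + k) := by
        obtain ⟨N, hN⟩ := Nat.exists_eq_succ_of_ne_zero (Fintype.card_ne_zero (α := κ))
        rw [hN, Nat.succ_sub_one, Nat.succ_eq_add_one]
        ring
      rwa [hdeg] at h

/-- The kernel of the left annihilator of an injective real matrix is contained in its range. -/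
lemma exists_mulVec_eq_of_leftAnnihilator {ι κ : Type*} [Fintype ι] [DecidableEq ι] [Fintype κ]
    [DecidableEq κ] {P : Matrix ι κ ℝ} (hP : ∀ v, P.mulVec v = 0 → v = 0) {y : ι → ℝ}
    (hy : (leftAnnihilator P).mulVec y = 0) : ∃ z, P.mulVec z = y := by
  have hdet : (P.transpose * P).det ≠ 0 := by
    intro h
    obtain ⟨v, hv, hv'⟩ := Matrix.exists_mulVec_eq_zero_iff.mpr h
    have h1 : P.conjTranspose * P = P.transpose * P := by
      rw [Matrix.conjTranspose_eq_transpose_of_trivial]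
    rw [← h1, Matrix.conjTranspose_mul_self_mulVec_eq_zero] at hv'
    exact hv (hP v hv')
  rw [leftAnnihilator, Matrix.sub_mulVec, Matrix.smul_mulVec, Matrix.one_mulVec, sub_eq_zero,
    Matrix.mul_assoc, ← Matrix.mulVec_mulVec] at hy
  refine ⟨(P.transpose * P).det⁻¹ • ((P.transpose * P).adjugate * P.transpose).mulVec y, ?_⟩
  rw [Matrix.mulVec_smul, ← hy, smul_smul, inv_mul_cancel₀ hdet, one_smul]

section Symbol

variable {n k : ℕ} {V W : Type*}
  [NormedAddCommGroup V] [InnerProductSpace ℝ V] [FiniteDimensional ℝ V]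
  [NormedAddCommGroup W] [InnerProductSpace ℝ W] [FiniteDimensional ℝ W]

/-- The symbol as a matrix of polynomials, with respect to the standard orthonormal bases. -/
noncomputable def symbolMatrix (A : CoeffOp n k V W) :
    Matrix (Fin (Module.finrank ℝ W)) (Fin (Module.finrank ℝ V)) (MvPolynomial (Fin n) ℝ) :=
  Matrix.of fun i a => ∑ I : Fin k → Fin n,
    ⟪stdOrthonormalBasis ℝ W i, A I (stdOrthonormalBasis ℝ V a)⟫ • ∏ r, MvPolynomial.X (I r)

lemma isHomogeneous_symbolMatrix (A : CoeffOp n k V W) (i : Fin (Module.finrank ℝ W))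
    (a : Fin (Module.finrank ℝ V)) : (symbolMatrix A i a).IsHomogeneous k := by
  refine MvPolynomial.IsHomogeneous.sum _ _ _ fun I _ => ?_
  rw [MvPolynomial.smul_eq_C_mul]
  refine MvPolynomial.IsHomogeneous.C_mul ?_ _
  simpa using MvPolynomial.IsHomogeneous.prod Finset.univ
    (fun r => (MvPolynomial.X (I r) : MvPolynomial (Fin n) ℝ)) (fun _ => 1)
    fun r _ => MvPolynomial.isHomogeneous_X ℝ (I r)

lemma eval_symbolMatrix (A : CoeffOp n k V W) (ξ : Euc n) (i : Fin (Module.finrank ℝ W))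
    (a : Fin (Module.finrank ℝ V)) :
    MvPolynomial.eval (fun r => ξ r) (symbolMatrix A i a) =
      ⟪stdOrthonormalBasis ℝ W i, symbolMap n k A ξ (stdOrthonormalBasis ℝ V a)⟫ := by
  simp [symbolMatrix, symbolMap, MvPolynomial.smul_eval, inner_sum,
    inner_smul_right, mul_comm]

lemma eval_symbolMatrix_mulVec (A : CoeffOp n k V W) (ξ : Euc n)
    (v : Fin (Module.finrank ℝ V) → ℝ) (i : Fin (Module.finrank ℝ W)) :
    ((symbolMatrix A).map (MvPolynomial.eval fun r => ξ r)).mulVec v i =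
      ⟪stdOrthonormalBasis ℝ W i, symbolMap n k A ξ (∑ a, v a • stdOrthonormalBasis ℝ V a)⟫ := by
  simp [Matrix.mulVec, dotProduct, eval_symbolMatrix, inner_sum, inner_smul_right, mul_comm]

/-- The rows of the left annihilator of the symbol, evaluated at `η`, as vectors in `W`. -/
noncomputable def annVec (A : CoeffOp n k V W) (i : Fin (Module.finrank ℝ W)) (η : Euc n) : W :=
  ∑ j, MvPolynomial.eval (fun r => η r) (leftAnnihilator (symbolMatrix A) i j) •
    stdOrthonormalBasis ℝ W j

lemma mem_range_symbolMap {A : CoeffOp n k V W} (hell : IsElliptic n k A) {ξ : Euc n} (hξ : ξ ≠ 0)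
    {w : W} (hw : ∀ i, ⟪annVec A i ξ, w⟫ = 0) : w ∈ LinearMap.range (symbolMap n k A ξ) := by
  have ext_inner {w w' : W}
      (h : ∀ i, ⟪stdOrthonormalBasis ℝ W i, w⟫ = ⟪stdOrthonormalBasis ℝ W i, w'⟫) : w = w' :=
    (stdOrthonormalBasis ℝ W).repr.injective (by
      ext i
      simpa only [OrthonormalBasis.repr_apply_apply] using h i)
  obtain ⟨z, hz⟩ := exists_mulVec_eq_of_leftAnnihilator
    (P := (symbolMatrix A).map (MvPolynomial.eval fun r => ξ r))
    (y := fun j => ⟪stdOrthonormalBasis ℝ W j, w⟫) (fun v hv => by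
      have h1 : symbolMap n k A ξ (∑ a, v a • stdOrthonormalBasis ℝ V a) = 0 :=
        ext_inner fun i => by
          rw [← eval_symbolMatrix_mulVec, hv]
          simp
      have h2 := hell ξ hξ (h1.trans (map_zero _).symm)
      funext a
      have h3 := (stdOrthonormalBasis ℝ V).toBasis.linearIndependent
      rw [Fintype.linearIndependent_iff] at h3
      exact h3 v (by simpa using h2) a) (by
      rw [← map_leftAnnihilator]
      funext i
      simpa [annVec, sum_inner, inner_smul_left, Matrix.mulVec, dotProduct] using hw i)
  refine ⟨∑ a, z a • stdOrthonormalBasis ℝ V a, ext_inner fun i => ?_⟩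
  rw [← eval_symbolMatrix_mulVec, hz]

lemma mem_span_annVec {A : CoeffOp n k V W} (hell : IsElliptic n k A)
    (hwc : IsWeaklyCanceling n k A) {v : W} (hv : ∀ w, InKerL n k A w → ⟪v, w⟫ = 0) :
    v ∈ Submodule.span ℝ (Set.range fun p : Fin (Module.finrank ℝ W) × Euc n =>
      annVec A p.1 p.2) := by
  rw [← Submodule.orthogonal_orthogonal (Submodule.span ℝ _)]
  intro w hw
  rw [real_inner_comm]
  refine hv w (hwc w fun ξ hξ => mem_range_symbolMap hell ?_ fun i => ?_)
  · rintro rfl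
    simp at hξ
  · exact hw _ (Submodule.subset_span ⟨(i, ξ), rfl⟩)

end Symbol

section SmoothEstimate

variable {n k : ℕ} {V W : Type*}
  [NormedAddCommGroup V] [InnerProductSpace ℝ V]
  [NormedAddCommGroup W] [InnerProductSpace ℝ W]

/-- The scalar function `x ↦ ⟪w, φ x⟫` attached to a smooth vector-valued function. -/
def innerComp {E : Type*} [NormedAddCommGroup E] [InnerProductSpace ℝ E] (w : E) {φ : Euc n → E}
    (hφ : ContDiff ℝ (⊤ : ℕ∞) φ) : smoothFun n :=
  ⟨fun x => ⟪w, φ x⟫, by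
    change ContDiff ℝ (⊤ : ℕ∞) fun x => ⟪w, φ x⟫
    exact contDiff_const.inner ℝ hφ⟩

lemma innerComp_apply {E : Type*} [NormedAddCommGroup E] [InnerProductSpace ℝ E] (w : E)
    {φ : Euc n → E} (hφ : ContDiff ℝ (⊤ : ℕ∞) φ) (x : Euc n) :
    (innerComp w hφ : Euc n → ℝ) x = ⟪w, φ x⟫ := rfl

lemma iteratedFDeriv_innerComp {E : Type*} [NormedAddCommGroup E] [InnerProductSpace ℝ E] (w : E)
    {φ : Euc n → E} (hφ : ContDiff ℝ (⊤ : ℕ∞) φ) (m : ℕ) (x : Euc n) :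
    iteratedFDeriv ℝ m (innerComp w hφ : Euc n → ℝ) x =
      (innerSL ℝ w).compContinuousMultilinearMap (iteratedFDeriv ℝ m φ x) :=
  (innerSL ℝ w).iteratedFDeriv_comp_left hφ.contDiffAt (by exact_mod_cast le_top)

lemma norm_iteratedFDeriv_innerComp_le {E : Type*} [NormedAddCommGroup E]
    [InnerProductSpace ℝ E] (w : E) {φ : Euc n → E} (hφ : ContDiff ℝ (⊤ : ℕ∞) φ) (m : ℕ)
    (x : Euc n) :
    ‖iteratedFDeriv ℝ m (innerComp w hφ : Euc n → ℝ) x‖ ≤ ‖w‖ * ‖iteratedFDeriv ℝ m φ x‖ := by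
  rw [iteratedFDeriv_innerComp]
  refine (ContinuousLinearMap.norm_compContinuousMultilinearMap_le _ _).trans ?_
  rw [innerSL_apply_norm]

lemma contDiff_Aapply [FiniteDimensional ℝ V] (A : CoeffOp n k V W) {u : Euc n → V}
    (hu : ContDiff ℝ (⊤ : ℕ∞) u) :
    ContDiff ℝ (⊤ : ℕ∞) (Aapply n k A u) := by
  refine ContDiff.sum fun I _ => ?_
  have h1 : ContDiff ℝ (⊤ : ℕ∞) (iteratedFDeriv ℝ k u) :=
    hu.iteratedFDeriv_right (by norm_cast)
  have h2 := (ContinuousMultilinearMap.apply ℝ (fun _ : Fin k => Euc n) V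
    (fun i => stdVec n (I i))).contDiff.comp h1 (n := ((⊤ : ℕ∞) : WithTop ℕ∞))
  exact (LinearMap.toContinuousLinearMap (A I)).contDiff.comp h2

lemma hasCompactSupport_Aapply (A : CoeffOp n k V W) {u : Euc n → V} (hu : HasCompactSupport u) :
    HasCompactSupport (Aapply n k A u) := by
  refine (hu.iteratedFDeriv (𝕜 := ℝ) k).mono fun x hx => ?_
  rw [Function.mem_support] at hx ⊢
  contrapose! hx
  simp [Aapply, dirDeriv, hx]

/-- The integrals on the right-hand side of the estimate. -/
noncomputable def derivSum {E E' : Type*} [NormedAddCommGroup E] [NormedSpace ℝ E]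
    [NormedAddCommGroup E'] (l : ℕ) (f : Euc n → E') (g : Euc n → E) : ℝ :=
  ∑ j ∈ Finset.Icc 1 l, ∫ x, ‖f x‖ * (‖x‖ ^ j * ‖iteratedFDeriv ℝ j g x‖)

lemma integrable_norm_mul_iteratedFDeriv {E E' : Type*} [NormedAddCommGroup E] [NormedSpace ℝ E]
    [NormedAddCommGroup E'] {f : Euc n → E'} (hf : Continuous f) (hfc : HasCompactSupport f)
    {g : Euc n → E} (hg : ContDiff ℝ (⊤ : ℕ∞) g) (j : ℕ) :
    Integrable (fun x => ‖f x‖ * (‖x‖ ^ j * ‖iteratedFDeriv ℝ j g x‖)) volume := by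
  refine Continuous.integrable_of_hasCompactSupport ?_ hfc.norm.mul_right
  have := hg.continuous_iteratedFDeriv (m := j) (by exact_mod_cast le_top)
  fun_prop

variable [FiniteDimensional ℝ V] [FiniteDimensional ℝ W]

lemma innerComp_Aapply (A : CoeffOp n k V W) {u : Euc n → V} (hu : ContDiff ℝ (⊤ : ℕ∞) u)
    (j : Fin (Module.finrank ℝ W)) :
    innerComp (stdOrthonormalBasis ℝ W j) (contDiff_Aapply A hu) =
      ∑ a, polyDiff n (symbolMatrix A j a) (innerComp (stdOrthonormalBasis ℝ V a) hu) := by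
  ext x
  rw [innerComp_apply]
  have h (I : Fin k → Fin n) : dirDeriv n k I u x =
      ∑ a, ⟪stdOrthonormalBasis ℝ V a, dirDeriv n k I u x⟫ • stdOrthonormalBasis ℝ V a :=
    ((stdOrthonormalBasis ℝ V).sum_repr' _).symm
  have h' (I : Fin k → Fin n) (a : Fin (Module.finrank ℝ V)) :
      (polyDiff n (∏ r, MvPolynomial.X (I r)) (innerComp (stdOrthonormalBasis ℝ V a) hu) :
        Euc n → ℝ) x = ⟪stdOrthonormalBasis ℝ V a, dirDeriv n k I u x⟫ := by
    rw [polyDiff_prod_X_apply]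
    dsimp only
    rw [iteratedFDeriv_innerComp]
    rfl
  simp only [symbolMatrix, Matrix.of_apply, map_sum, map_smul, LinearMap.sum_apply,
    LinearMap.smul_apply, Submodule.coe_sum, Submodule.coe_smul, Finset.sum_apply, Pi.smul_apply,
    h', smul_eq_mul, Aapply, inner_sum]
  rw [Finset.sum_comm]
  refine Finset.sum_congr rfl fun I _ => ?_
  conv_lhs => rw [h I]
  simp [inner_sum, inner_smul_right, mul_comm]

lemma sum_polyDiff_leftAnnihilator (A : CoeffOp n k V W) {u : Euc n → V}
    (hu : ContDiff ℝ (⊤ : ℕ∞) u) (i : Fin (Module.finrank ℝ W)) :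
    ∑ j, polyDiff n (leftAnnihilator (symbolMatrix A) i j)
      (innerComp (stdOrthonormalBasis ℝ W j) (contDiff_Aapply A hu)) = 0 := by
  have hj (j) : polyDiff n (leftAnnihilator (symbolMatrix A) i j)
      (innerComp (stdOrthonormalBasis ℝ W j) (contDiff_Aapply A hu)) =
      ∑ a, polyDiff n (leftAnnihilator (symbolMatrix A) i j * symbolMatrix A j a)
        (innerComp (stdOrthonormalBasis ℝ V a) hu) := by
    rw [innerComp_Aapply, map_sum]
    refine Finset.sum_congr rfl fun a _ => ?_
    rw [map_mul, Module.End.mul_apply]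
  rw [Finset.sum_congr rfl fun j _ => hj j, Finset.sum_comm]
  refine Finset.sum_eq_zero fun a _ => ?_
  rw [← LinearMap.sum_apply, ← map_sum]
  have h : ∑ j, leftAnnihilator (symbolMatrix A) i j * symbolMatrix A j a = 0 :=
    congrFun (congrFun (leftAnnihilator_mul (symbolMatrix A)) i) a
  rw [h]
  simp

lemma exists_abs_integral_mul_inner_annVec_le (A : CoeffOp n k V W)
    (i : Fin (Module.finrank ℝ W)) (η : Euc n) :
    ∃ C : ℝ, 0 ≤ C ∧ ∀ u : Euc n → V, ContDiff ℝ (⊤ : ℕ∞) u → HasCompactSupport u →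
      ∀ g : smoothFun n, |∫ x, (g : Euc n → ℝ) x * ⟪annVec A i η, Aapply n k A u x⟫| ≤
        C * derivSum (Module.finrank ℝ V * (k + k)) (Aapply n k A u) (g : Euc n → ℝ) := by
  have hhom (j) : (leftAnnihilator (symbolMatrix A) i j).IsHomogeneous
      (Module.finrank ℝ V * (k + k)) := by
    simpa using isHomogeneous_leftAnnihilator (isHomogeneous_symbolMatrix A) i j
  set l := Module.finrank ℝ V * (k + k)
  set q := leftAnnihilator (symbolMatrix A) i
  choose C hC hrem using fun j => exists_abs_polyDiff_pow_mul_sub_le η (hhom j)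
  have hl : (0 : ℝ) < l.factorial := by exact_mod_cast l.factorial_pos
  refine ⟨(l.factorial : ℝ)⁻¹ * ∑ j, C j, mul_nonneg (by positivity)
    (Finset.sum_nonneg fun j _ => hC j), fun u hu huc g => ?_⟩
  set f := Aapply n k A u
  have hf : ContDiff ℝ (⊤ : ℕ∞) f := contDiff_Aapply A hu
  have hfc : HasCompactSupport f := hasCompactSupport_Aapply A huc
  set F := fun j => innerComp (stdOrthonormalBasis ℝ W j) hf with hF
  have hFc (j) : HasCompactSupport (F j : Euc n → ℝ) :=
    hfc.mono fun x hx => by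
      rw [Function.mem_support] at hx ⊢
      contrapose! hx
      change ⟪_, f x⟫ = (0 : ℝ)
      rw [hx, inner_zero_right]
  set G := (mulEnd (innerFun η) ^ l) g
  set R := fun (j) (x : Euc n) => (polyDiff n (q j) G : Euc n → ℝ) x -
    (l.factorial : ℝ) * MvPolynomial.eval (fun r => η r) (q j) * (g : Euc n → ℝ) x
  have hzero : ∑ j, ∫ x, (polyDiff n (q j) G : Euc n → ℝ) x * (F j : Euc n → ℝ) x = 0 := by
    have h1 (j) : ∫ x, (polyDiff n (q j) G : Euc n → ℝ) x * (F j : Euc n → ℝ) x =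
        (-1) ^ l * ∫ x, (G : Euc n → ℝ) x * (polyDiff n (q j) (F j) : Euc n → ℝ) x := by
      rw [(integral_mul_polyDiff (hhom j) (F j) (hFc j) G).2, ← mul_assoc, ← mul_pow]
      simp
    simp only [h1]
    rw [← Finset.mul_sum, ← integral_finsetSum _ fun j _ => smoothFun_integrable_mul _ _
      (integral_mul_polyDiff (hhom j) (F j) (hFc j) G).1]
    have h2 (x : Euc n) : ∑ j, (G : Euc n → ℝ) x * (polyDiff n (q j) (F j) : Euc n → ℝ) x = 0 := by
      rw [← Finset.mul_sum]
      have h3 := congrArg (fun h : smoothFun n => (h : Euc n → ℝ) x)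
        (sum_polyDiff_leftAnnihilator A hu i)
      simp only [Submodule.coe_sum, Finset.sum_apply] at h3
      rw [h3]
      simp
    simp [h2]
  have hmain : (l.factorial : ℝ) * ∫ x, (g : Euc n → ℝ) x * ⟪annVec A i η, f x⟫ =
      -∑ j, ∫ x, R j x * (F j : Euc n → ℝ) x := by
    have h1 (j) : ∫ x, R j x * (F j : Euc n → ℝ) x =
        (∫ x, (polyDiff n (q j) G : Euc n → ℝ) x * (F j : Euc n → ℝ) x) -
        (l.factorial : ℝ) * (MvPolynomial.eval (fun r => η r) (q j) *
          ∫ x, (g : Euc n → ℝ) x * (F j : Euc n → ℝ) x) := by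
      simp only [R, sub_mul, mul_assoc]
      rw [integral_sub (smoothFun_integrable_mul _ _ (hFc j))
        (((smoothFun_integrable_mul _ _ (hFc j)).const_mul _).const_mul _)]
      simp only [integral_const_mul]
    simp only [h1]
    rw [Finset.sum_sub_distrib, hzero, zero_sub, neg_neg, ← Finset.mul_sum]
    congr 1
    simp only [← integral_const_mul]
    rw [← integral_finsetSum _ fun j _ =>
      (smoothFun_integrable_mul _ _ (hFc j)).const_mul _]
    refine integral_congr_ae (Eventually.of_forall fun x => ?_)
    simp only [annVec, sum_inner, inner_smul_left, Finset.mul_sum]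
    refine Finset.sum_congr rfl fun j _ => ?_
    simp only [hF, innerComp_apply, RCLike.conj_to_real]
    ring
  have hbound (j) : |∫ x, R j x * (F j : Euc n → ℝ) x| ≤ C j * derivSum l f (g : Euc n → ℝ) := by
    rw [derivSum, ← integral_finsetSum _ fun m _ =>
      integrable_norm_mul_iteratedFDeriv hf.continuous hfc (smoothFun_contDiff g) m,
      ← integral_const_mul, ← Real.norm_eq_abs]
    refine norm_integral_le_of_norm_le ((integrable_finsetSum _ fun m _ =>
      integrable_norm_mul_iteratedFDeriv hf.continuous hfc
        (smoothFun_contDiff g) m).const_mul _) (Eventually.of_forall fun x => ?_)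
    rw [norm_mul, ← Finset.mul_sum, mul_left_comm, mul_comm]
    refine mul_le_mul ?_ (hrem j g x) (norm_nonneg _) (norm_nonneg _)
    refine (norm_inner_le_norm _ _).trans ?_
    rw [OrthonormalBasis.norm_eq_one, one_mul]
  have h3 : |∫ x, (g : Euc n → ℝ) x * ⟪annVec A i η, f x⟫| =
      (l.factorial : ℝ)⁻¹ * |∑ j, ∫ x, R j x * (F j : Euc n → ℝ) x| := by
    rw [← abs_neg (∑ j, _), ← hmain, abs_mul, abs_of_pos hl, inv_mul_cancel_left₀ hl.ne']
  rw [h3, mul_assoc, Finset.sum_mul]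
  gcongr
  exact (Finset.abs_sum_le_sum_abs _ _).trans (Finset.sum_le_sum fun j _ => hbound j)

lemma exists_abs_integral_mul_inner_le (A : CoeffOp n k V W) {e : W}
    (he : e ∈ Submodule.span ℝ (Set.range fun p : Fin (Module.finrank ℝ W) × Euc n =>
      annVec A p.1 p.2)) :
    ∃ C : ℝ, 0 ≤ C ∧ ∀ u : Euc n → V, ContDiff ℝ (⊤ : ℕ∞) u → HasCompactSupport u →
      ∀ g : smoothFun n, |∫ x, (g : Euc n → ℝ) x * ⟪e, Aapply n k A u x⟫| ≤
        C * derivSum (Module.finrank ℝ V * (k + k)) (Aapply n k A u) (g : Euc n → ℝ) := by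
  induction he using Submodule.span_induction with
  | mem e he =>
    obtain ⟨p, rfl⟩ := he
    exact exists_abs_integral_mul_inner_annVec_le A p.1 p.2
  | zero => exact ⟨0, le_rfl, fun u _ _ g => by simp⟩
  | add e e' _ _ he he' =>
    obtain ⟨C, hC, h⟩ := he
    obtain ⟨C', hC', h'⟩ := he'
    refine ⟨C + C', add_nonneg hC hC', fun u hu huc g => ?_⟩
    have hint (e : W) :
        Integrable (fun x => (g : Euc n → ℝ) x * ⟪e, Aapply n k A u x⟫) volume :=
      smoothFun_integrable_mul (innerComp e (contDiff_Aapply A hu)) g <|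
        (hasCompactSupport_Aapply A huc).comp_left (g := fun w => ⟪e, w⟫) (inner_zero_right e)
    have hadd : ∫ x, (g : Euc n → ℝ) x * ⟪e + e', Aapply n k A u x⟫ =
        (∫ x, (g : Euc n → ℝ) x * ⟪e, Aapply n k A u x⟫) +
          ∫ x, (g : Euc n → ℝ) x * ⟪e', Aapply n k A u x⟫ := by
      rw [← integral_add (hint e) (hint e')]
      simp only [inner_add_left, mul_add]
    rw [hadd, add_mul]
    exact (abs_add_le _ _).trans (add_le_add (h u hu huc g) (h' u hu huc g))
  | smul c e _ he =>
    obtain ⟨C, hC, h⟩ := he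
    refine ⟨|c| * C, by positivity, fun u hu huc g => ?_⟩
    simp only [inner_smul_left, RCLike.conj_to_real, mul_left_comm _ c, integral_const_mul]
    rw [abs_mul, mul_assoc]
    exact mul_le_mul_of_nonneg_left (h u hu huc g) (abs_nonneg c)

/-- The estimate for a function `φ` that is smooth on the whole space. -/
lemma exists_abs_integral_inner_le_of_contDiff {A : CoeffOp n k V W} (hell : IsElliptic n k A)
    (hwc : IsWeaklyCanceling n k A) :
    ∃ C : ℝ, 0 ≤ C ∧ ∀ u : Euc n → V, ContDiff ℝ (⊤ : ℕ∞) u → HasCompactSupport u →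
      ∀ φ : Euc n → W, ContDiff ℝ (⊤ : ℕ∞) φ →
        (∀ (x : Euc n) (w : W), InKerL n k A w → ⟪φ x, w⟫ = 0) →
        |∫ x, ⟪φ x, Aapply n k A u x⟫| ≤
          C * derivSum (Module.finrank ℝ V * (k + k)) (Aapply n k A u) φ := by
  set S := Submodule.span ℝ (Set.range fun p : Fin (Module.finrank ℝ W) × Euc n =>
    annVec A p.1 p.2)
  set e := stdOrthonormalBasis ℝ S
  choose C hC h using fun s => exists_abs_integral_mul_inner_le A (e s).2
  refine ⟨∑ s, C s, Finset.sum_nonneg fun s _ => hC s, fun u hu huc φ hφ hker => ?_⟩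
  have hf := contDiff_Aapply A hu
  have hfc := hasCompactSupport_Aapply A huc
  have hexp (x : Euc n) : ⟪φ x, Aapply n k A u x⟫ =
      ∑ s, (innerComp (e s : W) hφ : Euc n → ℝ) x * ⟪(e s : W), Aapply n k A u x⟫ := by
    have h1 := congrArg (Subtype.val) (e.sum_repr' ⟨φ x, mem_span_annVec hell hwc (hker x)⟩)
    simp only [Submodule.coe_sum, Submodule.coe_smul, Submodule.coe_inner] at h1
    conv_lhs => rw [← h1]
    simp [sum_inner, inner_smul_left, innerComp_apply]
  have hint (s) : Integrable (fun x =>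
      (innerComp (e s : W) hφ : Euc n → ℝ) x * ⟪(e s : W), Aapply n k A u x⟫) volume :=
    smoothFun_integrable_mul (innerComp (e s : W) hf) (innerComp (e s : W) hφ) <|
      hfc.comp_left (g := fun w => ⟪(e s : W), w⟫) (inner_zero_right _)
  simp only [hexp]
  rw [integral_finsetSum _ fun s _ => hint s, Finset.sum_mul]
  refine (Finset.abs_sum_le_sum_abs _ _).trans (Finset.sum_le_sum fun s _ => ?_)
  refine (h s u hu huc _).trans (mul_le_mul_of_nonneg_left ?_ (hC s))
  refine Finset.sum_le_sum fun j _ => integral_mono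
    (integrable_norm_mul_iteratedFDeriv hf.continuous hfc (smoothFun_contDiff _) j)
    (integrable_norm_mul_iteratedFDeriv hf.continuous hfc hφ j) fun x => ?_
  have h1 := norm_iteratedFDeriv_innerComp_le (e s : W) hφ j x
  rw [← Submodule.coe_norm, e.norm_eq_one, one_mul] at h1
  dsimp only
  gcongr

end SmoothEstimate

section Cutoff

variable {n : ℕ} {E : Type*} [NormedAddCommGroup E] [NormedSpace ℝ E]

/-- A smooth cutoff that vanishes near the origin and equals `1` away from it, with
scale-invariant bounds on its derivatives. -/
lemma exists_cutoff (n : ℕ) : ∃ θ : Euc n → ℝ, ContDiff ℝ (⊤ : ℕ∞) θ ∧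
    (∀ x, ‖x‖ ≤ 1 → θ x = 0) ∧ (∀ x, 2 ≤ ‖x‖ → θ x = 1) ∧
    ∃ K : ℕ → ℝ, ∀ i x, ‖x‖ ^ i * ‖iteratedFDeriv ℝ i θ x‖ ≤ K i := by
  let χ : ContDiffBump (0 : Euc n) := ⟨1, 2, one_pos, one_lt_two⟩
  have hχ : ContDiff ℝ (⊤ : ℕ∞) χ := χ.contDiff
  refine ⟨fun x => 1 - χ x, contDiff_const.sub hχ, fun x hx => ?_, fun x hx => ?_, ?_⟩
  · simp [χ.one_of_mem_closedBall (x := x) (by simpa [χ] using hx)]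
  · simp [χ.zero_of_le_dist (x := x) (by simpa [χ] using hx)]
  have hbdd (i : ℕ) : ∃ C, ∀ x, ‖‖x‖ ^ i * ‖iteratedFDeriv ℝ i χ x‖‖ ≤ C := by
    have hc := hχ.continuous_iteratedFDeriv (m := i) (by exact_mod_cast le_top)
    exact Continuous.bounded_above_of_compact_support (by fun_prop)
      (χ.hasCompactSupport.iteratedFDeriv (𝕜 := ℝ) i).norm.mul_left
  choose C hC using hbdd
  refine ⟨fun i => 1 + C i, fun i x => ?_⟩
  have h1 : ‖x‖ ^ i * ‖iteratedFDeriv ℝ i (fun _ : Euc n => (1 : ℝ)) x‖ ≤ 1 := by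
    rcases eq_or_ne i 0 with rfl | hi
    · simp
    · simp [iteratedFDeriv_const_of_ne hi]
  have h2 : iteratedFDeriv ℝ i (fun x => 1 - χ x) x =
      iteratedFDeriv ℝ i (fun _ : Euc n => (1 : ℝ)) x - iteratedFDeriv ℝ i χ x :=
    iteratedFDeriv_sub_apply contDiffAt_const (hχ.contDiffAt.of_le (by exact_mod_cast le_top))
  have h3 := (le_abs_self _).trans (hC i x)
  rw [h2]
  calc ‖x‖ ^ i * ‖iteratedFDeriv ℝ i (fun _ : Euc n => (1 : ℝ)) x - iteratedFDeriv ℝ i χ x‖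
      ≤ ‖x‖ ^ i * (‖iteratedFDeriv ℝ i (fun _ : Euc n => (1 : ℝ)) x‖ +
          ‖iteratedFDeriv ℝ i χ x‖) := by
        gcongr
        exact norm_sub_le _ _
    _ ≤ 1 + C i := by
        rw [mul_add]
        exact add_le_add h1 h3

lemma norm_pow_mul_iteratedFDeriv_comp_smul_le {θ : Euc n → ℝ} (hθ : ContDiff ℝ (⊤ : ℕ∞) θ)
    {K : ℕ → ℝ} (hK : ∀ i x, ‖x‖ ^ i * ‖iteratedFDeriv ℝ i θ x‖ ≤ K i) (c : ℝ) (i : ℕ)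
    (x : Euc n) : ‖x‖ ^ i * ‖iteratedFDeriv ℝ i (fun x => θ (c • x)) x‖ ≤ K i := by
  rw [iteratedFDeriv_comp_const_smul c (hθ.of_le (by exact_mod_cast le_top)), norm_smul, norm_pow]
  calc ‖x‖ ^ i * (‖c‖ ^ i * ‖iteratedFDeriv ℝ i θ (c • x)‖)
      = ‖c • x‖ ^ i * ‖iteratedFDeriv ℝ i θ (c • x)‖ := by
        rw [norm_smul, mul_pow]
        ring
    _ ≤ K i := hK i _

lemma contDiff_cutoff_smul {θ : Euc n → ℝ} (hθ : ContDiff ℝ (⊤ : ℕ∞) θ)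
    (hθ0 : ∀ x, ‖x‖ ≤ 1 → θ x = 0) {φ : Euc n → E}
    (hφ : ContDiffOn ℝ (⊤ : ℕ∞) φ {x : Euc n | x ≠ 0}) (c : ℝ) :
    ContDiff ℝ (⊤ : ℕ∞) fun x => θ (c • x) • φ x := by
  rw [contDiff_iff_contDiffAt]
  intro x
  rcases eq_or_ne x 0 with rfl | hx
  · have h : Tendsto (fun x : Euc n => ‖c • x‖) (𝓝 0) (𝓝 0) := by
      have : Continuous fun x : Euc n => ‖c • x‖ := by fun_prop
      simpa using this.tendsto 0
    refine (contDiffAt_const (c := (0 : E))).congr_of_eventuallyEq ?_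
    filter_upwards [h.eventually_le_const one_pos] with y hy
    rw [hθ0 _ hy, zero_smul]
  · exact (hθ.comp (contDiff_const_smul c)).contDiffAt.smul
      (hφ.contDiffAt (isOpen_ne.mem_nhds hx))

lemma norm_pow_mul_iteratedFDeriv_cutoff_smul_le {θ : Euc n → ℝ} (hθ : ContDiff ℝ (⊤ : ℕ∞) θ)
    {K : ℕ → ℝ} (hK : ∀ i x, ‖x‖ ^ i * ‖iteratedFDeriv ℝ i θ x‖ ≤ K i) {φ : Euc n → E}
    (hφ : ContDiffOn ℝ (⊤ : ℕ∞) φ {x : Euc n | x ≠ 0}) (c : ℝ) (j : ℕ) {x : Euc n} (hx : x ≠ 0) :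
    ‖x‖ ^ j * ‖iteratedFDeriv ℝ j (fun x => θ (c • x) • φ x) x‖ ≤
      ∑ i ∈ Finset.range (j + 1), (j.choose i * K i) *
        (‖x‖ ^ (j - i) * ‖iteratedFDeriv ℝ (j - i) φ x‖) := by
  have hopen : IsOpen {x : Euc n | x ≠ 0} := isOpen_ne
  have h := norm_iteratedFDerivWithin_smul_le (hθ.comp (contDiff_const_smul c)).contDiffOn hφ
    hopen.uniqueDiffOn (x := x) hx (n := j) (by exact_mod_cast le_top)
  simp only [iteratedFDerivWithin_of_isOpen _ hopen (show x ∈ {x : Euc n | x ≠ 0} from hx)] at h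
  refine (mul_le_mul_of_nonneg_left h (by positivity)).trans ?_
  rw [Finset.mul_sum]
  refine Finset.sum_le_sum fun i hi => ?_
  have hij : i + (j - i) = j := Nat.add_sub_cancel' (Nat.lt_succ_iff.mp (Finset.mem_range.mp hi))
  calc ‖x‖ ^ j * (j.choose i * ‖iteratedFDeriv ℝ i (fun x => θ (c • x)) x‖ *
        ‖iteratedFDeriv ℝ (j - i) φ x‖)
      = j.choose i * (‖x‖ ^ i * ‖iteratedFDeriv ℝ i (fun x => θ (c • x)) x‖) *
          (‖x‖ ^ (j - i) * ‖iteratedFDeriv ℝ (j - i) φ x‖) := by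
        nth_rewrite 1 [← hij]
        rw [pow_add]
        ring
    _ ≤ _ := by
        gcongr
        exact norm_pow_mul_iteratedFDeriv_comp_smul_le hθ hK c i x

lemma eventually_cutoff_smul_eventuallyEq {θ : Euc n → ℝ} (hθ1 : ∀ x, 2 ≤ ‖x‖ → θ x = 1)
    (φ : Euc n → E) {x : Euc n} (hx : x ≠ 0) :
    ∀ᶠ m : ℕ in atTop, (fun x => θ ((m : ℝ) • x) • φ x) =ᶠ[𝓝 x] φ := by
  have hpos : 0 < ‖x‖ := norm_pos_iff.mpr hx
  filter_upwards [tendsto_natCast_atTop_atTop.eventually_ge_atTop (4 / ‖x‖)] with m hm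
  filter_upwards [continuous_norm.tendsto x |>.eventually_const_lt (half_lt_self hpos)] with y hy
  rw [hθ1, one_smul]
  rw [norm_smul, Real.norm_natCast]
  rw [div_le_iff₀ hpos] at hm
  nlinarith [(Nat.cast_nonneg m : (0 : ℝ) ≤ m)]

end Cutoff

section SingularEstimate

variable {n : ℕ} {E : Type*} [NormedAddCommGroup E] [NormedSpace ℝ E]

lemma integrable_norm_mul_of_locallyIntegrable {E' : Type*} [NormedAddCommGroup E']
    {f : Euc n → E'} (hf : Continuous f) (hfc : HasCompactSupport f) {h : Euc n → ℝ}
    (hh : LocallyIntegrable h volume) : Integrable (fun x => ‖f x‖ * h x) volume :=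
  hh.integrable_smul_left_of_hasCompactSupport hf.norm hfc.norm

lemma ae_ne_zero [NeZero n] : ∀ᵐ x : Euc n, x ≠ 0 :=
  compl_mem_ae_iff.mpr (measure_singleton 0)

/-- Cutting off near the origin does not change the weighted integrals in the limit. -/
lemma tendsto_derivSum_cutoff_smul [NeZero n] {E' : Type*} [NormedAddCommGroup E'] {θ : Euc n → ℝ}
    (hθ : ContDiff ℝ (⊤ : ℕ∞) θ) (hθ0 : ∀ x, ‖x‖ ≤ 1 → θ x = 0) (hθ1 : ∀ x, 2 ≤ ‖x‖ → θ x = 1)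
    {K : ℕ → ℝ} (hK : ∀ i x, ‖x‖ ^ i * ‖iteratedFDeriv ℝ i θ x‖ ≤ K i) {f : Euc n → E'}
    (hf : Continuous f) (hfc : HasCompactSupport f) {φ : Euc n → E}
    (hφ : ContDiffOn ℝ (⊤ : ℕ∞) φ {x : Euc n | x ≠ 0}) {l : ℕ}
    (hloc : ∀ j : ℕ, j ≤ l →
      LocallyIntegrable (fun x : Euc n => ‖x‖ ^ j * ‖iteratedFDeriv ℝ j φ x‖) volume) :
    Tendsto (fun m : ℕ => derivSum l f fun x => θ ((m : ℝ) • x) • φ x) atTop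
      (𝓝 (derivSum l f φ)) := by
  refine tendsto_finsetSum _ fun j hj => ?_
  have hjl := (Finset.mem_Icc.mp hj).2
  refine tendsto_integral_of_dominated_convergence
    (fun x => ∑ i ∈ Finset.range (j + 1), (j.choose i * K i) *
      (‖f x‖ * (‖x‖ ^ (j - i) * ‖iteratedFDeriv ℝ (j - i) φ x‖))) (fun m => ?_) ?_ (fun m => ?_) ?_
  · exact (integrable_norm_mul_iteratedFDeriv hf hfc
      (contDiff_cutoff_smul hθ hθ0 hφ m) j).aestronglyMeasurable
  · exact integrable_finsetSum _ fun i _ => (integrable_norm_mul_of_locallyIntegrable hf hfc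
      (hloc (j - i) ((Nat.sub_le j i).trans hjl))).const_mul _
  · filter_upwards [ae_ne_zero] with x hx
    rw [Real.norm_of_nonneg (by positivity)]
    refine (mul_le_mul_of_nonneg_left (norm_pow_mul_iteratedFDeriv_cutoff_smul_le hθ hK hφ m j hx)
      (norm_nonneg (f x))).trans_eq ?_
    rw [Finset.mul_sum]
    exact Finset.sum_congr rfl fun i _ => mul_left_comm _ _ _
  · filter_upwards [ae_ne_zero] with x hx
    refine tendsto_const_nhds.congr' ?_
    filter_upwards [eventually_cutoff_smul_eventuallyEq hθ1 φ hx] with m hm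
    rw [(hm.iteratedFDeriv ℝ j).eq_of_nhds]

lemma tendsto_integral_inner_cutoff_smul [NeZero n] {W : Type*} [NormedAddCommGroup W]
    [InnerProductSpace ℝ W] {θ : Euc n → ℝ} (hθ : ContDiff ℝ (⊤ : ℕ∞) θ)
    (hθ0 : ∀ x, ‖x‖ ≤ 1 → θ x = 0) (hθ1 : ∀ x, 2 ≤ ‖x‖ → θ x = 1) {K : ℝ} (hK : ∀ x, |θ x| ≤ K)
    {f : Euc n → W} (hf : Continuous f) (hfc : HasCompactSupport f) {φ : Euc n → W}
    (hφ : ContDiffOn ℝ (⊤ : ℕ∞) φ {x : Euc n | x ≠ 0})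
    (hloc : LocallyIntegrable (fun x => ‖φ x‖) volume) :
    Tendsto (fun m : ℕ => ∫ x, ⟪θ ((m : ℝ) • x) • φ x, f x⟫) atTop (𝓝 (∫ x, ⟪φ x, f x⟫)) := by
  refine tendsto_integral_of_dominated_convergence (fun x => K * (‖f x‖ * ‖φ x‖)) (fun m => ?_) ?_
    (fun m => Eventually.of_forall fun x => ?_) ?_
  · exact ((contDiff_cutoff_smul hθ hθ0 hφ m).continuous.inner hf).aestronglyMeasurable
  · exact (integrable_norm_mul_of_locallyIntegrable hf hfc hloc).const_mul _
  · refine (norm_inner_le_norm _ _).trans ?_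
    rw [norm_smul, Real.norm_eq_abs, mul_assoc, mul_comm ‖φ x‖]
    gcongr
    exact hK _
  · filter_upwards [ae_ne_zero] with x hx
    refine tendsto_const_nhds.congr' ?_
    filter_upwards [eventually_cutoff_smul_eventuallyEq hθ1 φ hx] with m hm
    rw [hm.eq_of_nhds]

end SingularEstimate

/-- Lemma 3.1: if `𝒜` is elliptic of order `k ≥ n` and satisfies (WC),
then there are `l ≥ 1` and `C` such that for all `u ∈ C^∞_c(ℝ^n, V)` and all
`φ ∈ C^∞(ℝ^n \ {0}, im 𝓛*)` (equivalently, `φ ⊥ ker 𝓛` pointwise) with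
`|x|^j |D^j φ| ∈ L¹_loc` for `j = 0, …, l`, one has
`|∫ ⟨φ, 𝒜 u⟩| ≤ C ∑_{j=1}^l ∫ |𝒜 u| |x|^j |D^j φ|`. -/
theorem statement14 (n k : ℕ) (hn : 1 ≤ n) (hnk : n ≤ k) {V W : Type*}
    [NormedAddCommGroup V] [InnerProductSpace ℝ V] [FiniteDimensional ℝ V]
    [NormedAddCommGroup W] [InnerProductSpace ℝ W] [FiniteDimensional ℝ W]
    (A : CoeffOp n k V W) (hA : IsSymmetricOp n k A) (hell : IsElliptic n k A)
    (hwc : IsWeaklyCanceling n k A) :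
    ∃ (l : ℕ) (C : ℝ), 1 ≤ l ∧
      ∀ u : Euc n → V, ContDiff ℝ (⊤ : ℕ∞) u → HasCompactSupport u →
        ∀ φ : Euc n → W, ContDiffOn ℝ (⊤ : ℕ∞) φ {x : Euc n | x ≠ 0} →
          (∀ (x : Euc n) (w : W), InKerL n k A w → ⟪φ x, w⟫ = 0) →
          (∀ j : ℕ, j ≤ l →
            LocallyIntegrable (fun x : Euc n => ‖x‖ ^ j * ‖iteratedFDeriv ℝ j φ x‖) volume) →
          |∫ x, ⟪φ x, Aapply n k A u x⟫| ≤
            C * ∑ j ∈ Finset.Icc 1 l,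
              ∫ x, ‖Aapply n k A u x‖ * (‖x‖ ^ j * ‖iteratedFDeriv ℝ j φ x‖) := by
  have : NeZero n := ⟨by omega⟩
  obtain ⟨C, hC, hmain⟩ := exists_abs_integral_inner_le_of_contDiff hell hwc
  obtain ⟨θ, hθ, hθ0, hθ1, K, hK⟩ := exists_cutoff n
  refine ⟨Module.finrank ℝ V * (k + k) + 1, C, Nat.le_add_left _ _,
    fun u hu huc φ hφ hker hloc => ?_⟩
  have hf := (contDiff_Aapply A hu).continuous
  have hfc := hasCompactSupport_Aapply A huc
  have hleft := tendsto_integral_inner_cutoff_smul hθ hθ0 hθ1 (K := K 0)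
    (fun x => by simpa using hK 0 x) hf hfc hφ (by simpa using hloc 0 (Nat.zero_le _))
  have hright := tendsto_derivSum_cutoff_smul hθ hθ0 hθ1 hK hf hfc hφ
    fun j hj => hloc j (hj.trans (Nat.le_succ _))
  have hle := le_of_tendsto_of_tendsto' hleft.abs (hright.const_mul C) fun m =>
    hmain u hu huc _ (contDiff_cutoff_smul hθ hθ0 hφ m) fun x w hw => by
      rw [inner_smul_left, hker x w hw, mul_zero]
  refine hle.trans (mul_le_mul_of_nonneg_left ?_ hC)
  exact Finset.sum_le_sum_of_subset_of_nonneg (Finset.Icc_subset_Icc le_rfl (Nat.le_succ _))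
    fun j _ _ => integral_nonneg fun x => by positivity
end

section
/- Let 𝒜 be a homogeneous constant-coefficient differential operator of order k on ℝ^n. Suppose there exist 1 ≤ j ≤ k and 1 < p < ∞ such that every u ∈ BV^𝒜_loc(ℝ^n) satisfies D^{k−j}u ∈ t^{j,p}(x) for ℒ^n-almost every x ∈ ℝ^n. Then 𝒜 is elliptic. -/
open MeasureTheory Metric Filter
open scoped ENNReal RealInnerProductSpace Topology

section LinearProfile

variable {E G : Type*} [NormedAddCommGroup E] [NormedSpace ℝ E]
  [NormedAddCommGroup G] [NormedSpace ℝ G]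

/-- A directional derivative of a smooth map is smooth. -/
theorem contDiff_fderiv_apply_const {φ : E → G} (hφ : ContDiff ℝ (⊤ : ℕ∞) φ) (e : E) :
    ContDiff ℝ (⊤ : ℕ∞) fun x => fderiv ℝ φ x e :=
  (hφ.fderiv_right (m := (⊤ : ℕ∞)) (by simp)).clm_apply contDiff_const

theorem contDiff_iteratedFDeriv_apply_const {φ : E → G} (hφ : ContDiff ℝ (⊤ : ℕ∞) φ) (m : ℕ)
    (w : Fin m → E) : ContDiff ℝ (⊤ : ℕ∞) fun x => iteratedFDeriv ℝ m φ x w :=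
  (ContinuousMultilinearMap.apply ℝ (fun _ : Fin m => E) G w).contDiff.comp
    (hφ.iteratedFDeriv_right (m := (⊤ : ℕ∞)) (by exact_mod_cast le_top))

theorem hasCompactSupport_iteratedFDeriv_apply_const {φ : E → G} (hφ : HasCompactSupport φ)
    (m : ℕ) (w : Fin m → E) : HasCompactSupport fun x => iteratedFDeriv ℝ m φ x w :=
  (HasCompactSupport.iteratedFDeriv hφ m).comp_left (g := fun M : E [×m]→L[ℝ] G => M w) (by simp)

/-- The iterated derivative along `w` is a first derivative along `w 0`. -/
theorem iteratedFDeriv_succ_apply_eq_fderiv {φ : E → G} (hφ : ContDiff ℝ (⊤ : ℕ∞) φ) (m : ℕ)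
    (w : Fin (m + 1) → E) (x : E) :
    iteratedFDeriv ℝ (m + 1) φ x w =
      fderiv ℝ (fun y => iteratedFDeriv ℝ m φ y (Fin.tail w)) x (w 0) := by
  rw [iteratedFDeriv_succ_apply_left]
  have hd : DifferentiableAt ℝ (iteratedFDeriv ℝ m φ) x :=
    (hφ.iteratedFDeriv_right (m := (⊤ : ℕ∞)) (by exact_mod_cast le_top)).differentiable (by simp) x
  have h := ((ContinuousMultilinearMap.apply ℝ (fun _ : Fin m => E) G
    (Fin.tail w)).hasFDerivAt.comp x hd.hasFDerivAt).fderiv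
  exact (congrArg (fun T : E →L[ℝ] G => T (w 0)) h).symm

/-- A directional derivative commutes with iterated derivatives. -/
theorem fderiv_iteratedFDeriv_apply {φ : E → G} (hφ : ContDiff ℝ (⊤ : ℕ∞) φ) (e : E) (m : ℕ)
    (w : Fin m → E) (x : E) :
    fderiv ℝ (fun y => iteratedFDeriv ℝ m φ y w) x e =
      iteratedFDeriv ℝ m (fun y => fderiv ℝ φ y e) x w := by
  induction m generalizing x with
  | zero => simp
  | succ m ih =>
    rw [iteratedFDeriv_succ_apply_eq_fderiv (contDiff_fderiv_apply_const hφ e)]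
    simp only [iteratedFDeriv_succ_apply_eq_fderiv hφ, ← ih]
    set ψ : E → G := fun y => iteratedFDeriv ℝ m φ y (Fin.tail w)
    have hψ : ContDiff ℝ (⊤ : ℕ∞) ψ := contDiff_iteratedFDeriv_apply_const hφ m _
    have hd : DifferentiableAt ℝ (fderiv ℝ ψ) x :=
      (hψ.fderiv_right (m := (⊤ : ℕ∞)) (by simp)).differentiable (by simp) x
    have hs : IsSymmSndFDerivAt ℝ ψ x := hψ.contDiffAt.isSymmSndFDerivAt (by
      rw [minSmoothness_of_isRCLikeNormedField]
      exact WithTop.coe_le_coe.2 (le_top : (2 : ℕ∞) ≤ ⊤))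
    rw [fderiv_clm_apply hd (by fun_prop), fderiv_clm_apply hd (by fun_prop)]
    simpa using hs.eq e (w 0)

variable {ℓ : E →L[ℝ] ℝ}

/-- The linear projection onto `ker ℓ` along `e`. -/
noncomputable def kerProj (ℓ : E →L[ℝ] ℝ) (e : E) : E →L[ℝ] E :=
  ContinuousLinearMap.id ℝ E - ℓ.smulRight ((ℓ e)⁻¹ • e)

theorem kerProj_self {e : E} (he : ℓ e ≠ 0) : kerProj ℓ e e = 0 := by
  simp [kerProj, smul_smul, he]

theorem contDiff_mul_kerProj {a : ℝ → ℝ} (ha : ContDiff ℝ (⊤ : ℕ∞) a) {b : E → ℝ}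
    (hb : ContDiff ℝ (⊤ : ℕ∞) b) (e : E) :
    ContDiff ℝ (⊤ : ℕ∞) fun x => a (ℓ x) * b (kerProj ℓ e x) :=
  (ha.comp ℓ.contDiff).mul (hb.comp (kerProj ℓ e).contDiff)

theorem iteratedFDeriv_mul_kerProj {a : ℝ → ℝ} (ha : ContDiff ℝ (⊤ : ℕ∞) a) {b : E → ℝ}
    (hb : ContDiff ℝ (⊤ : ℕ∞) b) {e : E} (he : ℓ e ≠ 0) (m : ℕ) (x : E) :
    iteratedFDeriv ℝ m (fun x => a (ℓ x) * b (kerProj ℓ e x)) x (fun _ => e) =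
      ℓ e ^ m * (b (kerProj ℓ e x) * iteratedDeriv m a (ℓ x)) := by
  induction m generalizing x with
  | zero => simp [mul_comm]
  | succ m ih =>
    rw [iteratedFDeriv_succ_apply_eq_fderiv (contDiff_mul_kerProj ha hb e)]
    have hfun : (fun y => iteratedFDeriv ℝ m (fun x => a (ℓ x) * b (kerProj ℓ e x)) y
        (Fin.tail fun _ : Fin (m + 1) => e)) =
        fun y => ℓ e ^ m * (b (kerProj ℓ e y) * iteratedDeriv m a (ℓ y)) := by
      funext y
      exact ih y
    rw [hfun]
    have ha' : HasDerivAt (iteratedDeriv m a) (iteratedDeriv (m + 1) a (ℓ x)) (ℓ x) := by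
      rw [iteratedDeriv_succ]
      exact (ha.differentiable_iteratedDeriv m (by exact_mod_cast ENat.natCast_lt_top m)
        _).hasDerivAt
    have h1 := ha'.comp_hasFDerivAt x ℓ.hasFDerivAt
    have h2 := (hb.differentiable (by simp) (kerProj ℓ e x)).hasFDerivAt.comp x
      (kerProj ℓ e).hasFDerivAt
    have h3 := ((h2.mul h1).const_mul (ℓ e ^ m)).fderiv
    refine (congrArg (fun T : E →L[ℝ] ℝ => T e) h3).trans ?_
    simp [kerProj_self he]
    ring

variable [FiniteDimensional ℝ E]

theorem isClosedEmbedding_prod_kerProj (ℓ : E →L[ℝ] ℝ) (e : E) :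
    Topology.IsClosedEmbedding (ℓ.prod (kerProj ℓ e)) := by
  refine LinearMap.isClosedEmbedding_of_injective (f := (ℓ.prod (kerProj ℓ e)).toLinearMap)
    (LinearMap.ker_eq_bot'.2 fun x hx => ?_)
  obtain ⟨h1, h2⟩ := Prod.ext_iff.1 hx
  have h1' : ℓ x = 0 := h1
  have h2' : kerProj ℓ e x = 0 := h2
  simpa [kerProj, h1'] using h2'

theorem hasCompactSupport_mul_kerProj {a : ℝ → ℝ} (ha : HasCompactSupport a) {b : E → ℝ}
    (hb : HasCompactSupport b) (e : E) :
    HasCompactSupport fun x => a (ℓ x) * b (kerProj ℓ e x) := by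
  have hK : IsCompact (ℓ.prod (kerProj ℓ e) ⁻¹' (tsupport a ×ˢ tsupport b)) :=
    (isClosedEmbedding_prod_kerProj ℓ e).isCompact_preimage (IsCompact.prod ha hb)
  refine HasCompactSupport.intro hK fun x hx => ?_
  by_cases h1 : ℓ x ∈ tsupport a
  · have h2 : kerProj ℓ e x ∉ tsupport b := fun h2 => hx (Set.mk_mem_prod h1 h2)
    simp [image_eq_zero_of_notMem_tsupport h2]
  · simp [image_eq_zero_of_notMem_tsupport h1]

variable [MeasurableSpace E] [BorelSpace E]
  {μ : Measure E} [μ.IsAddHaarMeasure] {f : ℝ → ℝ}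

/-- A profile `f ∘ ℓ` does not vary along `ker ℓ`. -/
theorem integral_comp_smul_fderiv_eq_zero (hf : LocallyIntegrable (fun x => f (ℓ x)) μ)
    {φ : E → G} (hφ : ContDiff ℝ (⊤ : ℕ∞) φ) (hc : HasCompactSupport φ) {w : E} (hw : ℓ w = 0) :
    ∫ x, f (ℓ x) • fderiv ℝ φ x w ∂μ = 0 := by
  have h := integral_bilinear_hasLineDerivAt_right_eq_neg_left_of_integrable (μ := μ)
    (f := fun x => f (ℓ x)) (f' := fun _ => 0) (g := φ) (g' := fun x => fderiv ℝ φ x w) (v := w)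
    (B := ContinuousLinearMap.lsmul ℝ ℝ) (by simp)
    (hf.integrable_smul_right_of_hasCompactSupport
      (contDiff_fderiv_apply_const hφ w).continuous (hc.fderiv_apply ℝ w))
    (hf.integrable_smul_right_of_hasCompactSupport hφ.continuous hc)
    (fun x _ => by simpa [HasLineDerivAt, hw] using hasDerivAt_const (0 : ℝ) (f (ℓ x)))
    (fun x _ => (hφ.differentiable (by simp) x).hasFDerivAt.hasLineDerivAt w)
  simpa using h

/-- Against a profile `f ∘ ℓ`, every direction acts as its component along `e` modulo `ker ℓ`. -/
theorem integral_comp_smul_iteratedFDeriv (hf : LocallyIntegrable (fun x => f (ℓ x)) μ)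
    {e : E} (he : ℓ e ≠ 0) (m : ℕ) (w : Fin m → E)
    {φ : E → G} (hφ : ContDiff ℝ (⊤ : ℕ∞) φ) (hc : HasCompactSupport φ) :
    ∫ x, f (ℓ x) • iteratedFDeriv ℝ m φ x w ∂μ =
      (∏ i, ℓ (w i) / ℓ e) • ∫ x, f (ℓ x) • iteratedFDeriv ℝ m φ x (fun _ => e) ∂μ := by
  induction m generalizing φ with
  | zero => simp
  | succ m ih =>
    set ψ : E → G := fun y => iteratedFDeriv ℝ m φ y (Fin.tail w) with hψdef
    have hψ : ContDiff ℝ (⊤ : ℕ∞) ψ := contDiff_iteratedFDeriv_apply_const hφ m _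
    have hψc : HasCompactSupport ψ := hasCompactSupport_iteratedFDeriv_apply_const hc m _
    have hint (v : E) : Integrable (fun x => f (ℓ x) • fderiv ℝ ψ x v) μ :=
      hf.integrable_smul_right_of_hasCompactSupport
        (contDiff_fderiv_apply_const hψ v).continuous (hψc.fderiv_apply ℝ v)
    have hker := integral_comp_smul_fderiv_eq_zero hf hψ hψc
      (w := w 0 - (ℓ (w 0) / ℓ e) • e) (by simp [he])
    have h0 : ∫ x, f (ℓ x) • fderiv ℝ ψ x (w 0) ∂μ =
        (ℓ (w 0) / ℓ e) • ∫ x, f (ℓ x) • fderiv ℝ ψ x e ∂μ := by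
      rw [← integral_smul, ← sub_eq_zero, ← integral_sub (hint _) (by exact (hint _).smul _), ← hker]
      congr 1 with x
      simp only [map_sub, map_smul, smul_sub, smul_comm (f (ℓ x))]
    calc ∫ x, f (ℓ x) • iteratedFDeriv ℝ (m + 1) φ x w ∂μ
        = (ℓ (w 0) / ℓ e) • ∫ x, f (ℓ x) • fderiv ℝ ψ x e ∂μ := by
          simp only [iteratedFDeriv_succ_apply_eq_fderiv hφ]
          exact h0
      _ = (ℓ (w 0) / ℓ e) • (∏ i, ℓ (Fin.tail w i) / ℓ e) • ∫ x, f (ℓ x) •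
            iteratedFDeriv ℝ m (fun y => fderiv ℝ φ y e) x (fun _ => e) ∂μ := by
          simp only [hψdef, fderiv_iteratedFDeriv_apply hφ]
          rw [ih _ (contDiff_fderiv_apply_const hφ e) (hc.fderiv_apply ℝ e)]
      _ = _ := by
          simp only [iteratedFDeriv_succ_apply_eq_fderiv hφ, ← fderiv_iteratedFDeriv_apply hφ]
          rw [smul_smul, Fin.prod_univ_succ]
          rfl

/-- The measure `b(Q x) dμ`, with `Q` the projection onto `ker ℓ`, is mapped by `ℓ` to a multiple
of Lebesgue measure. -/
theorem exists_map_withDensity_kerProj {e : E} (he : ℓ e ≠ 0) {b : E → ℝ} (hb : Continuous b)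
    (hc : HasCompactSupport b) {z : E} (hz : 0 < b (kerProj ℓ e z)) :
    ∃ C : NNReal, C ≠ 0 ∧
      (μ.withDensity fun x => ENNReal.ofReal (b (kerProj ℓ e x))).map ℓ = C • volume := by
  set ρ : E → ℝ≥0∞ := fun x => ENNReal.ofReal (b (kerProj ℓ e x)) with hρ
  have hcont : Continuous fun x => b (kerProj ℓ e x) := hb.comp (kerProj ℓ e).continuous
  have hρm : Measurable ρ := hcont.measurable.ennreal_ofReal
  set ν := (μ.withDensity ρ).map ℓ with hν
  have happ {S : Set ℝ} (hS : MeasurableSet S) : ν S = ∫⁻ x, S.indicator 1 (ℓ x) * ρ x ∂μ := by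
    rw [hν, Measure.map_apply ℓ.continuous.measurable hS,
      withDensity_apply _ (ℓ.continuous.measurable hS),
      ← lintegral_indicator (ℓ.continuous.measurable hS)]
    congr 1 with x
    by_cases h : ℓ x ∈ S <;> simp [h]
  have hinv : ν.IsAddLeftInvariant := ⟨fun t => by
    ext S hS
    rw [Measure.map_apply (measurable_const_add t) hS, happ hS, happ (measurable_const_add t hS),
      ← lintegral_add_left_eq_self (fun x => S.indicator 1 (ℓ x) * ρ x) ((t / ℓ e) • e)]
    congr 1 with x
    have h1 : ℓ ((t / ℓ e) • e + x) = t + ℓ x := by simp [he]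
    have h2 : ρ ((t / ℓ e) • e + x) = ρ x := by simp [hρ, kerProj_self he]
    simp only [h1, h2]
    rfl⟩
  have hfin : IsFiniteMeasureOnCompacts ν := ⟨fun K hK => by
    set T := ℓ.prod (kerProj ℓ e) ⁻¹' (K ×ˢ tsupport b)
    have hT : IsCompact T :=
      (isClosedEmbedding_prod_kerProj ℓ e).isCompact_preimage (hK.prod hc)
    have hlt : ∫⁻ x in T, ρ x ∂μ < ⊤ :=
      (hcont.continuousOn.integrableOn_compact hT).setLIntegral_lt_top
    refine lt_of_le_of_lt ?_ hlt
    rw [happ hK.measurableSet, ← lintegral_indicator hT.measurableSet]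
    refine lintegral_mono fun x => ?_
    by_cases h : ℓ x ∈ K
    · by_cases h' : kerProj ℓ e x ∈ tsupport b
      · have : x ∈ T := ⟨h, h'⟩
        simp [h, this]
      · simp [hρ, image_eq_zero_of_notMem_tsupport h']
    · simp [h]⟩
  refine ⟨ν.addHaarScalarFactor volume, fun h0 => ?_, Measure.isAddLeftInvariant_eq_smul _ _⟩
  have h1 : ν Set.univ = 0 := by
    rw [Measure.isAddLeftInvariant_eq_smul ν volume, h0]
    simp
  rw [happ .univ] at h1
  simp only [Set.indicator_univ, Pi.one_apply, one_mul] at h1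
  rw [lintegral_eq_zero_iff hρm] at h1
  have hopen : IsOpen {x | 0 < b (kerProj ℓ e x)} := isOpen_lt continuous_const hcont
  refine (hopen.measure_pos μ ⟨z, hz⟩).ne' (measure_mono_null (fun x hx => ?_) h1)
  simpa [hρ] using hx

theorem exists_lintegral_kerProj {e : E} (he : ℓ e ≠ 0) {b : E → ℝ} (hb : Continuous b)
    (hc : HasCompactSupport b) {z : E} (hz : 0 < b (kerProj ℓ e z)) :
    ∃ C : NNReal, C ≠ 0 ∧ ∀ h : ℝ → ℝ≥0∞, Measurable h →
      ∫⁻ x, ENNReal.ofReal (b (kerProj ℓ e x)) * h (ℓ x) ∂μ = C * ∫⁻ t, h t := by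
  obtain ⟨C, hC, hmap⟩ := exists_map_withDensity_kerProj (μ := μ) he hb hc hz
  have hm : Measurable fun x => ENNReal.ofReal (b (kerProj ℓ e x)) :=
    (hb.comp (kerProj ℓ e).continuous).measurable.ennreal_ofReal
  refine ⟨C, hC, fun h hh => ?_⟩
  have hhl : Measurable fun x => h (ℓ x) := hh.comp ℓ.continuous.measurable
  have key := lintegral_map (μ := μ.withDensity fun x => ENNReal.ofReal (b (kerProj ℓ e x)))
    hh ℓ.continuous.measurable
  rw [hmap, lintegral_withDensity_eq_lintegral_mul _ hm hhl] at key
  rw [lintegral_smul_measure, ENNReal.smul_def, smul_eq_mul] at key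
  exact key.symm

theorem exists_integral_kerProj {e : E} (he : ℓ e ≠ 0) {b : E → ℝ} (hb : Continuous b)
    (hc : HasCompactSupport b) (h0 : ∀ x, 0 ≤ b x) {z : E} (hz : 0 < b (kerProj ℓ e z)) :
    ∃ C : ℝ, C ≠ 0 ∧ ∀ h : ℝ → ℝ, Measurable h →
      ∫ x, b (kerProj ℓ e x) * h (ℓ x) ∂μ = C * ∫ t, h t := by
  obtain ⟨C, hC, hmap⟩ := exists_map_withDensity_kerProj (μ := μ) he hb hc hz
  have hm : Measurable fun x => ENNReal.ofReal (b (kerProj ℓ e x)) :=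
    (hb.comp (kerProj ℓ e).continuous).measurable.ennreal_ofReal
  refine ⟨C, by exact_mod_cast hC, fun h hh => ?_⟩
  have key := integral_map (μ := μ.withDensity fun x => ENNReal.ofReal (b (kerProj ℓ e x)))
    ℓ.continuous.measurable.aemeasurable hh.aestronglyMeasurable
  rw [hmap, integral_withDensity_eq_integral_toReal_smul hm (by simp),
    integral_smul_nnreal_measure] at key
  simp only [ENNReal.toReal_ofReal (h0 _), smul_eq_mul] at key
  rw [← key]
  rfl

theorem locallyIntegrable_comp_of_lintegral_lt_top {e : E} (he : ℓ e ≠ 0) (hf : Measurable f)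
    (hfin : ∫⁻ t, ‖f t‖ₑ < ⊤) : LocallyIntegrable (fun x => f (ℓ x)) μ := by
  intro x
  let b : ContDiffBump (kerProj ℓ e x) := ⟨1, 2, one_pos, one_lt_two⟩
  obtain ⟨C, -, hC⟩ := exists_lintegral_kerProj (μ := μ) he b.continuous b.hasCompactSupport
    (z := x) (b.pos_of_mem_ball (mem_ball_self b.rOut_pos))
  set U := kerProj ℓ e ⁻¹' ball (kerProj ℓ e x) 1
  have hU : IsOpen U := isOpen_ball.preimage (kerProj ℓ e).continuous
  refine ⟨U, hU.mem_nhds (mem_ball_self one_pos),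
    (hf.comp ℓ.continuous.measurable).aestronglyMeasurable, ?_⟩
  calc ∫⁻ y in U, ‖f (ℓ y)‖ₑ ∂μ
      ≤ ∫⁻ y in U, ENNReal.ofReal (b (kerProj ℓ e y)) * ‖f (ℓ y)‖ₑ ∂μ := by
        refine setLIntegral_mono' hU.measurableSet fun y hy => ?_
        rw [b.one_of_mem_closedBall (ball_subset_closedBall hy)]
        simp
    _ ≤ ∫⁻ y, ENNReal.ofReal (b (kerProj ℓ e y)) * ‖f (ℓ y)‖ₑ ∂μ := setLIntegral_le_lintegral _ _
    _ = C * ∫⁻ t, ‖f t‖ₑ := hC _ hf.enorm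
    _ < ⊤ := ENNReal.mul_lt_top ENNReal.coe_lt_top hfin

/-- If `h` has infinite integral on every interval, so does `h ∘ ℓ` on every ball. -/
theorem setLIntegral_ball_comp_eq_top {e : E} (he : ℓ e ≠ 0) {h : ℝ → ℝ≥0∞} (hm : Measurable h)
    (hinf : ∀ a b : ℝ, a < b → ∫⁻ t in Set.Ioo a b, h t = ⊤) (x : E) {r : ℝ} (hr : 0 < r) :
    ∫⁻ y in ball x r, h (ℓ y) ∂μ = ⊤ := by
  have hx := ball_mem_nhds x hr
  rw [(isClosedEmbedding_prod_kerProj ℓ e).isInducing.nhds_eq_comap] at hx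
  obtain ⟨S, hS, hSsub⟩ := hx
  obtain ⟨ε, hε, hεS⟩ := Metric.mem_nhds_iff.1 hS
  let b : ContDiffBump (kerProj ℓ e x) := ⟨ε / 2, ε, by positivity, by linarith⟩
  obtain ⟨C, hC0, hC⟩ := exists_lintegral_kerProj (μ := μ) he b.continuous b.hasCompactSupport
    (z := x) (b.pos_of_mem_ball (mem_ball_self b.rOut_pos))
  have hsub {y : E} (h1 : ℓ y ∈ ball (ℓ x) ε) (h2 : kerProj ℓ e y ∈ ball (kerProj ℓ e x) ε) :
      y ∈ ball x r := hSsub (hεS (by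
        rw [← ball_prod_same]
        exact ⟨h1, h2⟩))
  have key := hC ((ball (ℓ x) ε).indicator h) (hm.indicator measurableSet_ball)
  rw [lintegral_indicator measurableSet_ball, Real.ball_eq_Ioo, hinf _ _ (by linarith),
    ENNReal.mul_top (by exact_mod_cast hC0)] at key
  rw [eq_top_iff, ← key, ← lintegral_indicator measurableSet_ball]
  refine lintegral_mono fun y => ?_
  rw [← Real.ball_eq_Ioo]
  by_cases h1 : ℓ y ∈ ball (ℓ x) ε
  · by_cases h2 : kerProj ℓ e y ∈ ball (kerProj ℓ e x) ε
    · rw [Set.indicator_of_mem h1, Set.indicator_of_mem (hsub h1 h2)]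
      exact mul_le_of_le_one_left' (ENNReal.ofReal_le_one.2 b.le_one)
    · have h3 : b (kerProj ℓ e y) = 0 := b.zero_of_le_dist (not_lt.1 h2)
      simp [h3]
  · simp [Set.indicator_of_notMem h1]

/-- The Heaviside profile `1_{ℓ > 0}` has no locally integrable derivative of positive order
along `e`. -/
theorem not_exists_weak_deriv_heaviside {e : E} (he : ℓ e ≠ 0) {v : G} (hv : v ≠ 0) (m : ℕ)
    [CompleteSpace G] {g : E → G} (hg : LocallyIntegrable g μ) :
    ¬ ∀ φ : E → ℝ, ContDiff ℝ (⊤ : ℕ∞) φ → HasCompactSupport φ →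
      ∫ x, iteratedFDeriv ℝ (m + 1) φ x (fun _ => e) •
        ((Set.Ioi (0 : ℝ)).indicator 1 (ℓ x) : ℝ) • v ∂μ =
      (-1 : ℝ) ^ (m + 1) • ∫ x, φ x • g x ∂μ := by
  intro H
  let b : ContDiffBump (0 : E) := ⟨1, 2, one_pos, one_lt_two⟩
  let χ : ContDiffBump (0 : ℝ) := ⟨1, 2, one_pos, one_lt_two⟩
  let χ' : ContDiffBump (0 : ℝ) := ⟨2, 3, two_pos, by norm_num⟩
  obtain ⟨C, hC0, hC⟩ := exists_integral_kerProj (μ := μ) he b.continuous b.hasCompactSupport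
    b.nonneg' (z := 0) (by simpa using b.pos_of_mem_ball (mem_ball_self b.rOut_pos))
  let a : ℕ → ℝ → ℝ := fun N t => t ^ m * χ ((N + 1) * t)
  have hN (N : ℕ) : (0 : ℝ) < N + 1 := by positivity
  have ha (N : ℕ) : ContDiff ℝ (⊤ : ℕ∞) (a N) :=
    (contDiff_id.pow m).mul (χ.contDiff.comp (contDiff_const.mul contDiff_id))
  have hac (N : ℕ) : HasCompactSupport (a N) := by
    refine HasCompactSupport.mul_left
      (χ.hasCompactSupport.comp_homeomorph (Homeomorph.mulLeft₀ _ (hN N).ne'))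
  have ha0 (N : ℕ) : iteratedDeriv m (a N) 0 = m.factorial := by
    have hev : a N =ᶠ[𝓝 0] fun t => t ^ m := by
      have ht : Tendsto (fun t : ℝ => (N + 1 : ℝ) * t) (𝓝 0) (𝓝 0) := by
        simpa using (continuous_const_mul (N + 1 : ℝ)).tendsto 0
      filter_upwards [ht.eventually χ.eventuallyEq_one] with t ht
      simp [a, ht]
    rw [hev.iteratedDeriv_eq, iteratedDeriv_pow]
    simp [Nat.descFactorial_self]
  let Φ : ℕ → E → ℝ := fun N x => a N (ℓ x) * b (kerProj ℓ e x)
  have hleft (N : ℕ) : ∫ x, iteratedFDeriv ℝ (m + 1) (Φ N) x (fun _ => e) •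
      ((Set.Ioi (0 : ℝ)).indicator 1 (ℓ x) : ℝ) • v ∂μ =
      (ℓ e ^ (m + 1) * (C * -m.factorial)) • v := by
    have hmeas : Measurable (iteratedDeriv (m + 1) (a N)) :=
      ((ha N).continuous_iteratedDeriv (m + 1) (by exact_mod_cast le_top)).measurable
    have h1 := hC ((Set.Ioi 0).indicator (iteratedDeriv (m + 1) (a N)))
      (hmeas.indicator measurableSet_Ioi)
    rw [integral_indicator measurableSet_Ioi, iteratedDeriv_succ,
      HasCompactSupport.integral_Ioi_deriv_eq, ha0] at h1
    · rw [← h1, ← integral_const_mul, ← integral_smul_const]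
      congr 1 with x
      simp only [Φ]
      rw [iteratedFDeriv_mul_kerProj (ha N) b.contDiff he, smul_smul, iteratedDeriv_succ]
      by_cases hx : ℓ x ∈ Set.Ioi (0 : ℝ) <;> simp [hx]
    · exact (contDiff_iteratedFDeriv_apply_const (ha N) m fun _ => 1).of_le
        (by exact_mod_cast le_top)
    · exact hasCompactSupport_iteratedFDeriv_apply_const (hac N) m fun _ => 1
  have hright : Tendsto (fun N => ∫ x, Φ N x • g x ∂μ) atTop (𝓝 (∫ _, (0 : G) ∂μ)) := by
    refine tendsto_integral_of_dominated_convergence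
      (fun x => ‖(2 ^ m * (χ' (ℓ x) * b (kerProj ℓ e x))) • g x‖) (fun N => ?_) ?_
      (fun N => ae_of_all _ fun x => ?_) ?_
    · exact (hg.integrable_smul_left_of_hasCompactSupport
        (contDiff_mul_kerProj (ha N) b.contDiff e).continuous
        (hasCompactSupport_mul_kerProj (hac N) b.hasCompactSupport e)).aestronglyMeasurable
    · exact (hg.integrable_smul_left_of_hasCompactSupport
        (continuous_const.mul
          (contDiff_mul_kerProj χ'.contDiff b.contDiff e).continuous)
        (hasCompactSupport_mul_kerProj χ'.hasCompactSupport b.hasCompactSupport e).mul_left).norm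
    · rw [norm_smul, norm_smul]
      refine mul_le_mul_of_nonneg_right ?_ (norm_nonneg _)
      simp only [Φ, a, norm_mul, norm_pow, Real.norm_of_nonneg χ.nonneg,
        Real.norm_of_nonneg χ'.nonneg, Real.norm_of_nonneg b.nonneg, Real.norm_ofNat]
      rw [← mul_assoc]
      refine mul_le_mul_of_nonneg_right ?_ b.nonneg
      by_cases hx : ‖ℓ x‖ ≤ 2
      · rw [χ'.one_of_mem_closedBall (by simpa using hx)]
        exact mul_le_mul (pow_le_pow_left₀ (norm_nonneg _) hx m) χ.le_one χ.nonneg (by positivity)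
      · rw [χ.zero_of_le_dist]
        · rw [mul_zero]
          exact mul_nonneg (by positivity) χ'.nonneg
        · have : (0 : ℝ) ≤ N := N.cast_nonneg
          rw [dist_zero_right, norm_mul, Real.norm_of_nonneg (hN N).le]
          simp only [χ]
          nlinarith [not_le.1 hx]
    · have hker : ∀ᵐ x ∂μ, ℓ x ≠ 0 := by
        have := Measure.addHaar_submodule μ (LinearMap.ker ℓ.toLinearMap) (fun htop => he (by
          have : e ∈ LinearMap.ker ℓ.toLinearMap := htop ▸ Submodule.mem_top
          exact this))
        exact measure_mono_null (fun x hx => by simpa using hx) this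
      filter_upwards [hker] with x hx
      refine tendsto_const_nhds.congr' ?_
      obtain ⟨M, hM⟩ := exists_nat_ge (2 / ‖ℓ x‖)
      filter_upwards [eventually_ge_atTop M] with N hNM
      have h2 : 2 ≤ (N + 1 : ℝ) * ‖ℓ x‖ := by
        have : (M : ℝ) ≤ N := by exact_mod_cast hNM
        rw [← div_le_iff₀ (norm_pos_iff.2 hx)]
        linarith
      have h0 : χ ((N + 1) * ℓ x) = 0 := χ.zero_of_le_dist (by
        rwa [dist_zero_right, norm_mul, Real.norm_of_nonneg (hN N).le])
      simp [Φ, a, h0]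
  have heq (N : ℕ) := (hleft N).symm.trans (H (Φ N) (contDiff_mul_kerProj (ha N) b.contDiff e)
    (hasCompactSupport_mul_kerProj (hac N) b.hasCompactSupport e))
  have hlim := hright.const_smul ((-1 : ℝ) ^ (m + 1))
  simp only [← heq, integral_zero, smul_zero, tendsto_const_nhds_iff] at hlim
  simp [he, hC0, hv, Nat.factorial_ne_zero] at hlim

end LinearProfile

section RealLine

/-- An integrable function on the line that is not `p`-integrable on any interval. -/
theorem exists_integrable_nowhere_rpow_integrable {p : ℝ} (hp : 1 < p) :
    ∃ f : ℝ → ℝ, Measurable f ∧ ∫⁻ t, ‖f t‖ₑ < ⊤ ∧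
      ∀ a b : ℝ, a < b → ∫⁻ t in Set.Ioo a b, ‖f t‖ₑ ^ p = ⊤ := by
  have hp0 : 0 < p := by linarith
  set h : ℝ → ℝ≥0∞ := (Set.Ioo 0 1).indicator fun t => ENNReal.ofReal (t ^ (-p⁻¹)) with hh
  have hm : Measurable h := Measurable.indicator (by fun_prop) measurableSet_Ioo
  have hfin : ∫⁻ t, h t < ⊤ := by
    have hI : IntegrableOn (fun t : ℝ => t ^ (-p⁻¹)) (Set.Ioo 0 1) := by
      have := (intervalIntegral.intervalIntegrable_rpow' (a := 0) (b := 1) (r := -p⁻¹)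
        (by linarith [inv_lt_one_of_one_lt₀ hp]))
      exact ((intervalIntegrable_iff_integrableOn_Ioc_of_le zero_le_one).1 this).mono_set
        Set.Ioo_subset_Ioc_self
    rw [hh, lintegral_indicator measurableSet_Ioo]
    exact hI.setLIntegral_lt_top
  have hinf {δ : ℝ} (hδ : 0 < δ) (hδ1 : δ ≤ 1) : ∫⁻ t in Set.Ioo 0 δ, h t ^ p = ⊤ := by
    have hnot : ¬ IntegrableOn (fun t : ℝ => t⁻¹) (Set.Ioo 0 δ) := fun hc => by
      have := (intervalIntegrable_iff_integrableOn_Ioo_of_le hδ.le).2 hc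
      rw [intervalIntegrable_inv_iff] at this
      rcases this with h1 | h1
      · exact hδ.ne h1
      · exact h1 Set.left_mem_uIcc
    by_contra hne
    refine hnot ⟨measurable_inv.aestronglyMeasurable, ?_⟩
    rw [HasFiniteIntegral]
    refine lt_of_le_of_lt (le_of_eq (setLIntegral_congr_fun measurableSet_Ioo fun t ht => ?_))
      (lt_top_iff_ne_top.2 hne)
    have ht1 : t ∈ Set.Ioo (0 : ℝ) 1 := ⟨ht.1, ht.2.trans_le hδ1⟩
    simp only [hh, Set.indicator_of_mem ht1]
    rw [ENNReal.ofReal_rpow_of_nonneg (Real.rpow_nonneg ht.1.le _) hp0.le,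
      ← Real.rpow_mul ht.1.le, neg_mul, inv_mul_cancel₀ hp0.ne', Real.rpow_neg_one,
      Real.enorm_of_nonneg (inv_nonneg.2 ht.1.le)]
  set q : ℕ → ℝ := TopologicalSpace.denseSeq ℝ
  set c : ℕ → ℝ≥0∞ := fun i => 2⁻¹ ^ (i + 1)
  set H : ℝ → ℝ≥0∞ := fun t => ∑' i, c i * h (t - q i) with hH
  have hmi (i : ℕ) : Measurable fun t => h (t - q i) := hm.comp (measurable_id.sub_const _)
  have hHm : Measurable H := Measurable.tsum fun i => (hmi i).const_mul _
  have hHint : ∫⁻ t, H t < ⊤ := by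
    rw [hH, lintegral_tsum fun i => ((hmi i).const_mul _).aemeasurable]
    simp_rw [fun i => lintegral_const_mul (μ := volume) (c i) (hmi i),
      lintegral_sub_right_eq_self h, ENNReal.tsum_mul_right]
    have : ∑' i, c i = 1 := by
      rw [ENNReal.tsum_geometric_add_one, ENNReal.one_sub_inv_two, inv_inv,
        ENNReal.inv_mul_cancel two_ne_zero ENNReal.ofNat_ne_top]
    rw [this, one_mul]
    exact hfin
  have hae : ∀ᵐ t, ‖(H t).toReal‖ₑ = H t := by
    filter_upwards [ae_lt_top hHm hHint.ne] with t ht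
    rw [Real.enorm_of_nonneg ENNReal.toReal_nonneg, ENNReal.ofReal_toReal ht.ne]
  refine ⟨fun t => (H t).toReal, hHm.ennreal_toReal, ?_, fun a b hab => ?_⟩
  · rwa [lintegral_congr_ae hae]
  obtain ⟨i, haq, hqb⟩ :=
    (TopologicalSpace.denseRange_denseSeq ℝ).exists_mem_open isOpen_Ioo (Set.nonempty_Ioo.2 hab)
  set δ := min 1 (b - q i)
  have hδ : 0 < δ := lt_min one_pos (sub_pos.2 hqb)
  rw [eq_top_iff, lintegral_congr_ae (ae_restrict_of_ae (hae.mono fun t ht => by rw [ht])),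
    ← lintegral_indicator measurableSet_Ioo]
  have hc : c i ^ p ≠ 0 := by simp [c, hp0]
  calc ⊤ = c i ^ p * ∫⁻ t in Set.Ioo 0 δ, h t ^ p := by
        rw [hinf hδ (min_le_left _ _), ENNReal.mul_top hc]
    _ = c i ^ p * ∫⁻ t, (Set.Ioo 0 δ).indicator (fun t => h t ^ p) (t - q i) := by
        rw [lintegral_sub_right_eq_self ((Set.Ioo 0 δ).indicator fun t => h t ^ p),
          lintegral_indicator measurableSet_Ioo]
    _ = ∫⁻ t, c i ^ p * (Set.Ioo 0 δ).indicator (fun t => h t ^ p) (t - q i) := by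
        rw [lintegral_const_mul]
        exact ((hm.pow_const p).indicator measurableSet_Ioo).comp (measurable_id.sub_const _)
    _ ≤ ∫⁻ t, (Set.Ioo a b).indicator (fun t => H t ^ p) t := by
        refine lintegral_mono fun t => ?_
        by_cases ht : t - q i ∈ Set.Ioo 0 δ
        · have ht' : t ∈ Set.Ioo a b :=
            ⟨haq.trans (sub_pos.1 ht.1), by linarith [ht.2.trans_le (min_le_right _ _)]⟩
          simp only [Set.indicator_of_mem ht, Set.indicator_of_mem ht']
          rw [← ENNReal.mul_rpow_of_nonneg _ _ hp0.le]
          exact ENNReal.rpow_le_rpow (ENNReal.le_tsum i) hp0.le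
        · simp [Set.indicator_of_notMem ht]

end RealLine

section Profile

variable {n k : ℕ} {V W : Type*}
  [NormedAddCommGroup V] [InnerProductSpace ℝ V] [FiniteDimensional ℝ V]
  [NormedAddCommGroup W] [InnerProductSpace ℝ W] [FiniteDimensional ℝ W]

theorem innerSL_stdVec (ξ : Euc n) (i : Fin n) : innerSL ℝ ξ (stdVec n i) = ξ i := by
  simp [stdVec, EuclideanSpace.inner_single_right]

/-- A plane wave in a direction where the symbol annihilates its amplitude is `𝒜`-free. -/
theorem memBVAloc_profile (A : CoeffOp n k V W) {ξ : Euc n} {i : Fin n} (hi : ξ i ≠ 0) {v : V}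
    (hv : symbolMap n k A ξ v = 0) {f : ℝ → ℝ}
    (hf : LocallyIntegrable (fun x : Euc n => f (innerSL ℝ ξ x)) volume) :
    MemBVAloc n k A fun x => f (innerSL ℝ ξ x) • v := by
  refine ⟨fun x => (hf x).imp fun _ hs => ⟨hs.1, hs.2.smul_const v⟩, 0, 0, inferInstance, fun x => ?_, by simp,
    fun φ hφ => ?_⟩
  · exact ⟨Set.univ, univ_mem, by simp⟩
  have hi' : innerSL ℝ ξ (stdVec n i) ≠ 0 := by rwa [innerSL_stdVec]
  set z : W := ∫ x, f (innerSL ℝ ξ x) • iteratedFDeriv ℝ k φ x fun _ => stdVec n i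
  have hterm (I : Fin k → Fin n) :
      ∫ x, ⟪f (innerSL ℝ ξ x) • v, LinearMap.adjoint (A I) (dirDeriv n k I φ x)⟫ =
        ⟪(ξ i ^ k)⁻¹ • (∏ l, ξ (I l)) • A I v, z⟫ := by
    have h := integral_comp_smul_iteratedFDeriv hf hi' k (fun l => stdVec n (I l)) hφ.1 hφ.2
    simp only [innerSL_stdVec, Finset.prod_div_distrib, Finset.prod_const, Finset.card_univ,
      Fintype.card_fin] at h
    calc _ = ∫ x, ⟪A I v, f (innerSL ℝ ξ x) •
          iteratedFDeriv ℝ k φ x fun l => stdVec n (I l)⟫ := by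
          congr 1 with x
          rw [LinearMap.adjoint_inner_right, map_smul, real_inner_smul_left,
            real_inner_smul_right]
          rfl
      _ = ⟪A I v, ((∏ l, ξ (I l)) / ξ i ^ k) • z⟫ := by
          rw [integral_inner, h]
          exact hf.integrable_smul_right_of_hasCompactSupport
            (contDiff_iteratedFDeriv_apply_const hφ.1 k _).continuous
            (hasCompactSupport_iteratedFDeriv_apply_const hφ.2 k _)
      _ = _ := by
          simp only [real_inner_smul_left, real_inner_smul_right]
          ring
  simp only [symbolMap, LinearMap.sum_apply, LinearMap.smul_apply] at hv
  simp only [hterm, ← sum_inner, ← Finset.smul_sum, hv]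
  simp

/-- Membership in `t^{j,p}(x)` forces local `p`-integrability near `x`. -/
theorem MemT.exists_setLIntegral_lt_top {j : ℕ} {p : ℝ} (hp : 1 ≤ p) {u : Euc n → V} {x : Euc n}
    (h : MemT n j p u x) : ∃ r > 0, ∫⁻ y in ball x r, ‖u y‖ₑ ^ p < ⊤ := by
  have hp0 : 0 < p := by linarith
  obtain ⟨P, hP, hsmall⟩ := h
  have hev := (hsmall.eventually (gt_mem_nhds one_pos)).and self_mem_nhdsWithin
  obtain ⟨r, hr1, hr⟩ := hev.exists
  have hr : 0 < r := hr
  have hQ : ((volume (ball x r))⁻¹ *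
      ∫⁻ y in ball x r, (‖u y - P y‖₊ : ℝ≥0∞) ^ p) ^ (1 / p) ≠ ⊤ := by
    intro htop
    simp only [htop] at hr1
    rw [ENNReal.top_div_of_ne_top ENNReal.ofReal_ne_top] at hr1
    exact not_top_lt hr1
  have hI : ∫⁻ y in ball x r, (‖u y - P y‖₊ : ℝ≥0∞) ^ p ≠ ⊤ := by
    intro htop
    rw [htop, ENNReal.mul_top (ENNReal.inv_ne_zero.2 measure_ball_lt_top.ne),
      ENNReal.top_rpow_of_pos (by positivity)] at hQ
    exact hQ rfl
  have hPm : Measurable fun y => ‖P y‖ₑ ^ p := hP.1.continuous.enorm.measurable.pow_const p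
  have hPI : ∫⁻ y in ball x r, ‖P y‖ₑ ^ p < ⊤ := by
    obtain ⟨M, hM⟩ := (isCompact_closedBall x r).exists_bound_of_continuousOn
      hP.1.continuous.continuousOn
    calc ∫⁻ y in ball x r, ‖P y‖ₑ ^ p ≤ ∫⁻ _ in ball x r, ENNReal.ofReal M ^ p := by
          refine setLIntegral_mono' measurableSet_ball fun y hy => ?_
          refine ENNReal.rpow_le_rpow ?_ hp0.le
          rw [← ofReal_norm]
          exact ENNReal.ofReal_le_ofReal (hM y (ball_subset_closedBall hy))
      _ = ENNReal.ofReal M ^ p * volume (ball x r) := setLIntegral_const _ _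
      _ < ⊤ := ENNReal.mul_lt_top
          (ENNReal.rpow_lt_top_of_nonneg hp0.le ENNReal.ofReal_ne_top) measure_ball_lt_top
  refine ⟨r, hr, ?_⟩
  calc ∫⁻ y in ball x r, ‖u y‖ₑ ^ p
      ≤ ∫⁻ y in ball x r, 2 ^ (p - 1) * (‖u y - P y‖ₑ ^ p + ‖P y‖ₑ ^ p) := by
        refine lintegral_mono fun y => ?_
        refine le_trans (ENNReal.rpow_le_rpow ?_ hp0.le)
          (ENNReal.rpow_add_le_mul_rpow_add_rpow _ _ hp)
        simpa using enorm_add_le (u y - P y) (P y)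
    _ = 2 ^ (p - 1) * ((∫⁻ y in ball x r, ‖u y - P y‖ₑ ^ p) +
        ∫⁻ y in ball x r, ‖P y‖ₑ ^ p) := by
        rw [lintegral_const_mul' _ _
          (ENNReal.rpow_ne_top_of_nonneg (by linarith) ENNReal.ofNat_ne_top),
          lintegral_add_right _ hPm]
    _ < ⊤ := ENNReal.mul_lt_top
        (ENNReal.rpow_lt_top_of_nonneg (by linarith) ENNReal.ofNat_ne_top)
        (ENNReal.add_lt_top.2 ⟨lt_top_iff_ne_top.2 hI, hPI⟩)

theorem IsWeakDerivFamily.ae_eq_of_order_zero {u : Euc n → V}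
    {w : (Fin 0 → Fin n) → Euc n → V} (hu : LocallyIntegrable u volume)
    (h : IsWeakDerivFamily n 0 u w) (I : Fin 0 → Fin n) : w I =ᵐ[volume] u :=
  ae_eq_of_integral_contDiff_smul_eq (h.1 I) hu fun φ hφ hc => by
    simpa [dirDeriv] using (h.2 I φ ⟨hφ, hc⟩).symm

end Profile

/-- Lemma 6.2: if, for some `1 ≤ j ≤ k` and `1 < p < ∞`, every
`u ∈ BV^𝒜_loc` satisfies `D^{k-j} u ∈ t^{j,p}(x)` a.e., then `𝒜` is elliptic. -/
theorem statement17 (n k j : ℕ) (p : ℝ) {V W : Type*}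
    [NormedAddCommGroup V] [InnerProductSpace ℝ V] [FiniteDimensional ℝ V]
    [NormedAddCommGroup W] [InnerProductSpace ℝ W] [FiniteDimensional ℝ W]
    (A : CoeffOp n k V W) (hA : IsSymmetricOp n k A)
    (hj1 : 1 ≤ j) (hjk : j ≤ k) (hp1 : 1 < p)
    (hdiff : ∀ u : Euc n → V, MemBVAloc n k A u →
      ∃ v : (Fin (k - j) → Fin n) → Euc n → V, IsWeakDerivFamily n (k - j) u v ∧
        ∀ᵐ x ∂(volume : Measure (Euc n)), ∀ I, MemT n j p (v I) x) :
    IsElliptic n k A := by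
  intro ξ hξ
  rw [injective_iff_map_eq_zero]
  intro v hv
  by_contra hv0
  obtain ⟨i, hi⟩ : ∃ i, ξ i ≠ 0 := by
    by_contra! h
    exact hξ (PiLp.ext h)
  have he : innerSL ℝ ξ (stdVec n i) ≠ 0 := by rwa [innerSL_stdVec]
  generalize hm : k - j = m at hdiff
  cases m with
  | succ m =>
    have hloc : LocallyIntegrable
        (fun x : Euc n => (Set.Ioi (0 : ℝ)).indicator (1 : ℝ → ℝ) (innerSL ℝ ξ x)) volume := by
      have : (fun x : Euc n => (Set.Ioi (0 : ℝ)).indicator (1 : ℝ → ℝ) (innerSL ℝ ξ x)) =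
          (innerSL ℝ ξ ⁻¹' Set.Ioi 0).indicator 1 := rfl
      rw [this]
      exact (locallyIntegrable_const (1 : ℝ)).indicator
        (measurableSet_Ioi.preimage (innerSL ℝ ξ).continuous.measurable)
    obtain ⟨w, hw, -⟩ := hdiff _ (memBVAloc_profile A hi hv hloc)
    exact not_exists_weak_deriv_heaviside he hv0 m (hw.1 fun _ => i)
      fun φ hφ hc => hw.2 (fun _ => i) φ ⟨hφ, hc⟩
  | zero =>
    obtain ⟨f, hfm, hfin, hinf⟩ := exists_integrable_nowhere_rpow_integrable hp1
    have hu := memBVAloc_profile A hi hv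
      (locallyIntegrable_comp_of_lintegral_lt_top he hfm hfin)
    obtain ⟨w, hw, hT⟩ := hdiff _ hu
    obtain ⟨x, hx⟩ := hT.exists
    obtain ⟨r, hr, hlt⟩ := (hx Fin.elim0).exists_setLIntegral_lt_top hp1.le
    refine hlt.ne ?_
    have hae := hw.ae_eq_of_order_zero hu.1 Fin.elim0
    rw [lintegral_congr_ae (ae_restrict_of_ae (hae.mono fun y hy => by rw [hy]))]
    simp only [enorm_smul, ENNReal.mul_rpow_of_nonneg _ _ (zero_le_one.trans hp1.le)]
    rw [lintegral_mul_const _ (by fun_prop), setLIntegral_ball_comp_eq_top he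
      (hfm.enorm.pow_const p) hinf x hr, ENNReal.top_mul]
    simp [hv0, (zero_lt_one.trans hp1).not_gt]
end

section
/- On ℝ² (n = 2, k = 2), the second-order operator 𝒜₁ acting on u = (u₁, u₂) : ℝ² → ℝ² by 𝒜₁u := ((∂₁² − ∂₂²)u₁ + 2∂₁∂₂u₂, −2∂₁∂₂u₁ + (∂₁² − ∂₂²)u₂) is elliptic (indeed det 𝒜₁[ξ] = |ξ|⁴ for all ξ), is non-canceling (⋂_{ξ ∈ 𝕊¹} im 𝒜₁[ξ] ≠ {0}), and satisfies condition (WC): ∫_{𝕊¹} 𝒜₁^{-1}[ξ] dℋ¹(ξ) = 0. In particular, condition (WC) is strictly weaker than the canceling condition for elliptic operators. -/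
open MeasureTheory Metric Filter
open scoped ENNReal RealInnerProductSpace Topology

/-- The coefficients of the operator `𝒜₁` on `ℝ²`:
`𝒜₁ u = ((∂₁² - ∂₂²) u₁ + 2 ∂₁∂₂ u₂, -2 ∂₁∂₂ u₁ + (∂₁² - ∂₂²) u₂)`,
whose symbol is `𝒜₁[ξ] = [[ξ₁² - ξ₂², 2ξ₁ξ₂], [-2ξ₁ξ₂, ξ₁² - ξ₂²]]`. -/
noncomputable def A1coeff : CoeffOp 2 2 (EuclideanSpace ℝ (Fin 2)) (EuclideanSpace ℝ (Fin 2)) :=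
  fun I =>
    Matrix.toEuclideanLin
      (if I 0 = I 1 then (if I 0 = 0 then (1 : Matrix (Fin 2) (Fin 2) ℝ) else -1)
       else !![0, 1; -1, 0])

/-- The rotation of the Euclidean plane by a quarter turn. -/
noncomputable def quarterTurn : Euc 2 ≃ₗᵢ[ℝ] Euc 2 where
  toFun x := !₂[-x 1, x 0]
  invFun x := !₂[x 1, -x 0]
  map_add' x y := by ext i; fin_cases i <;> simp [add_comm]
  map_smul' c x := by ext i; fin_cases i <;> simp
  left_inv x := by ext i; fin_cases i <;> simp
  right_inv x := by ext i; fin_cases i <;> simp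
  norm_map' x := by simp [EuclideanSpace.norm_eq, Fin.sum_univ_two, add_comm]

lemma quarterTurn_apply_zero (x : Euc 2) : quarterTurn x 0 = -x 1 := rfl

lemma quarterTurn_apply_one (x : Euc 2) : quarterTurn x 1 = x 0 := rfl

/-- The integral over the unit circle of a function that is odd under the quarter turn vanishes. -/
lemma setIntegral_sphere_eq_zero_of_quarterTurn {E : Type*} [NormedAddCommGroup E]
    [NormedSpace ℝ E] (d : ℝ) (f : Euc 2 → E) (hf : ∀ ξ, f (quarterTurn ξ) = -f ξ) :
    ∫ ξ in sphere (0 : Euc 2) 1, f ξ ∂(μH[d]) = 0 := by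
  have hmp := quarterTurn.toIsometryEquiv.measurePreserving_hausdorffMeasure d
  have h := hmp.setIntegral_preimage_emb
    quarterTurn.toIsometryEquiv.toHomeomorph.measurableEmbedding f (sphere (0 : Euc 2) 1)
  have hs : quarterTurn.toIsometryEquiv ⁻¹' sphere (0 : Euc 2) 1 = sphere (0 : Euc 2) 1 := by
    ext x; simp
  rw [hs] at h
  simp only [LinearIsometryEquiv.coe_toIsometryEquiv, hf, integral_neg] at h
  have : IsAddTorsionFree E := .of_isTorsionFree ℝ E
  exact self_eq_neg.mp h.symm

lemma symbolMap_A1coeff (ξ : Euc 2) :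
    symbolMap 2 2 A1coeff ξ = Matrix.toEuclideanLin
      !![ξ 0 ^ 2 - ξ 1 ^ 2, 2 * ξ 0 * ξ 1; -(2 * ξ 0 * ξ 1), ξ 0 ^ 2 - ξ 1 ^ 2] := by
  have hsum (f : (Fin 2 → Fin 2) → (Euc 2 →ₗ[ℝ] Euc 2)) :
      ∑ I, f I = f ![0, 0] + f ![0, 1] + f ![1, 0] + f ![1, 1] := by
    rw [← (finTwoArrowEquiv (Fin 2)).symm.sum_comp, Fintype.sum_prod_type]
    simp [Fin.sum_univ_two, add_assoc]
  rw [symbolMap, hsum]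
  simp only [A1coeff, ← map_smul, ← map_add]
  congr 1
  ext i j
  fin_cases i <;> fin_cases j <;> simp [Fin.prod_univ_two] <;> ring

lemma det_symbolMap_A1coeff (ξ : Euc 2) :
    LinearMap.det (symbolMap 2 2 A1coeff ξ) = ‖ξ‖ ^ 4 := by
  have h : ‖ξ‖ ^ 4 = (ξ 0 ^ 2 + ξ 1 ^ 2) ^ 2 := by
    rw [show ‖ξ‖ ^ 4 = (‖ξ‖ ^ 2) ^ 2 by ring, EuclideanSpace.real_norm_sq_eq, Fin.sum_univ_two]
  rw [h, symbolMap_A1coeff, Matrix.toEuclideanLin, Matrix.toLpLin_eq_toLin, LinearMap.det_toLin,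
    Matrix.det_fin_two_of]
  ring

lemma isUnit_symbolMap_A1coeff {ξ : Euc 2} (hξ : ξ ≠ 0) :
    IsUnit (symbolMap 2 2 A1coeff ξ) := by
  rw [LinearMap.isUnit_iff_isUnit_det, det_symbolMap_A1coeff, isUnit_iff_ne_zero]
  exact pow_ne_zero 4 (norm_ne_zero_iff.mpr hξ)

lemma symbolMap_A1coeff_quarterTurn (ξ : Euc 2) :
    symbolMap 2 2 A1coeff (quarterTurn ξ) = -symbolMap 2 2 A1coeff ξ := by
  simp only [symbolMap_A1coeff, ← map_neg, quarterTurn_apply_zero, quarterTurn_apply_one]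
  congr 1
  ext i j
  fin_cases i <;> fin_cases j <;> simp <;> ring

lemma Adagger_A1coeff_quarterTurn (ξ : Euc 2) :
    Adagger 2 2 A1coeff (quarterTurn ξ) = -Adagger 2 2 A1coeff ξ := by
  simp [Adagger, symbolMap_A1coeff_quarterTurn, LinearMap.comp_neg, LinearMap.neg_comp]

lemma isSymmetricOp_A1coeff : IsSymmetricOp 2 2 A1coeff := by
  intro I σ
  have hσ : (σ 0 = 0 ∧ σ 1 = 1) ∨ (σ 0 = 1 ∧ σ 1 = 0) := by
    revert σ; decide
  rcases hσ with ⟨h0, h1⟩ | ⟨h0, h1⟩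
  · simp [A1coeff, h0, h1]
  · by_cases h : I 0 = I 1
    · simp [A1coeff, h0, h1, h]
    · simp [A1coeff, h0, h1, h, Ne.symm h]

lemma not_isCanceling_A1coeff : ¬ IsCanceling 2 2 A1coeff := by
  intro h
  have hmem : stdVec 2 0 ∈ ({0} : Set (Euc 2)) := by
    rw [← h]
    refine Set.mem_iInter₂.mpr fun ξ hξ => ?_
    have hsurj := ((Module.End.isUnit_iff _).mp
      (isUnit_symbolMap_A1coeff (ne_zero_of_mem_unit_sphere ⟨ξ, hξ⟩))).surjective
    exact hsurj _
  simp [stdVec] at hmem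

lemma isWeaklyCanceling_A1coeff : IsWeaklyCanceling 2 2 A1coeff := by
  intro w _ J
  refine setIntegral_sphere_eq_zero_of_quarterTurn _ _ fun ξ => ?_
  simp [Adagger_A1coeff_quarterTurn]

/-- Example 4.6: the operator `𝒜₁` on `ℝ²` is (symmetric,) elliptic with
`det 𝒜₁[ξ] = |ξ|⁴`, non-canceling, and satisfies condition (WC). In particular, condition
(WC) is strictly weaker than the cancellation condition for elliptic operators. -/
theorem statement19 :
    IsSymmetricOp 2 2 A1coeff ∧
    IsElliptic 2 2 A1coeff ∧
    (∀ ξ : Euc 2, LinearMap.det (symbolMap 2 2 A1coeff ξ) = ‖ξ‖ ^ 4) ∧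
    ¬ IsCanceling 2 2 A1coeff ∧
    IsWeaklyCanceling 2 2 A1coeff := by
  exact ⟨isSymmetricOp_A1coeff,
    fun _ hξ => ((Module.End.isUnit_iff _).mp (isUnit_symbolMap_A1coeff hξ)).injective,
    det_symbolMap_A1coeff, not_isCanceling_A1coeff, isWeaklyCanceling_A1coeff⟩
end
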